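/- arXiv:2402.13198 — 2 statements merged into one kernel-verified Lean document; each statement's English description precedes it below -/
import Mathlib

section
/- Fix reals u ≥ 1, θ ∈ (0,1) with (1−θ)u < 1, κ > 0, and constants A ≥ 0, B ≥ 0, C ≥ 0, δ > 0, ε > 0. Then there exists x₀ such that the following holds: for every finite nonempty set 𝒜 of positive integers with x := max 𝒜 ≥ x₀, setting y := x^{1/u}, for every real X > 0 and every multiplicative function γ : ℕ⁺ → [0,∞) satisfying (i) |∑_{p ≤ z, p prime} γ(p)·log p/p − κ·log z| ≤ A for all z ≥ 2, (ii) γ(p^α) ≤ B for all primes p and all integers α ≥ 1, and (iii) ∑_{1 ≤ d ≤ y^{uθ}} |A_d − γ(d)X/d| ≤ C·X/(log y)^δ where A_d := #{n ∈ 𝒜 : d ∣ n}, one has #{n ∈ 𝒜 : P⁺(n) ≤ y} ≥ (ρ_{θ,κ}(u) − ε)·#𝒜. -/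
open MeasureTheory

attribute [local instance] Classical.propDecidable

/-- Largest prime factor, with the convention `Pplus 1 = 1`. -/
def Pplus (n : ℕ) : ℕ := max 1 (n.primeFactors.sup id)

/-- The region `V_k(u,v)`. -/
def Vk (k : ℕ) (u v : ℝ) : Set (Fin k → ℝ) :=
  {t | (∀ i, t i ∈ Set.Ioo (0:ℝ) 1) ∧
    (∑ i ∈ Finset.univ.filter (fun i : Fin k => (i : ℕ) < k - 1), t i) < u - 1 ∧
    u - 1 < ∑ i, t i ∧ ∑ i, t i < u - v}

/-- The function `μ_k(u,v)`. -/
noncomputable def muk (k : ℕ) (u v : ℝ) : ℝ :=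
  if k = 1 then
    u⁻¹ * (volume (Set.Ioo (0:ℝ) 1 ∩ Set.Ioo (u-1) (u-v))).toReal
  else
    u⁻¹ * ∫ t in Vk k u v,
      ∏ j ∈ Finset.univ.filter (fun j : Fin k => (j : ℕ) < k - 1),
        (u - ∑ i ∈ Finset.univ.filter (fun i : Fin k => i ≤ j), t i)⁻¹

/-- `μ^{(κ)}(u,v) = ∑_{k ≥ 1} κ^k μ_k(u,v)`. -/
noncomputable def mukappa (κ u v : ℝ) : ℝ := ∑' k : ℕ, κ ^ (k+1) * muk (k+1) u v

/-- `ρ_{θ,κ}(u) = μ^{(κ)}(u, (1-θ)u)`. -/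
noncomputable def rhotheta (θ κ u : ℝ) : ℝ := mukappa κ u ((1-θ)*u)

/-- The probability that successive primes dividing an integer of logarithm `s`, drawn with
probability proportional to their logarithm, form the list `l`. -/
noncomputable def listWeight : ℝ → List ℕ → ℝ
  | _, [] => 1
  | s, p :: l => Real.log p / s * listWeight (s - Real.log p) l

lemma sum_log_primeFactors_le (n : ℕ) (hn : 0 < n) :
    ∑ p ∈ n.primeFactors, Real.log p ≤ Real.log n := by
  rw [← Real.log_prod (fun p hp => by
    exact_mod_cast (Nat.prime_of_mem_primeFactors hp).ne_zero)]
  have h := Nat.le_of_dvd hn (Nat.prod_primeFactors_dvd n)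
  apply Real.log_le_log
  · exact Finset.prod_pos fun p hp => by
      exact_mod_cast (Nat.prime_of_mem_primeFactors hp).pos
  · rw [← Nat.cast_prod]
    exact_mod_cast h

/-- The weights of a prefix-free set of lists of primes whose products divide `n` add up to
at most one. -/
lemma sum_listWeight_le_one (n : ℕ) : ∀ (s : ℝ) (L : Finset (List ℕ)), 0 < n →
    Real.log n ≤ s → (∀ l ∈ L, ∀ p ∈ l, p.Prime) → (∀ l ∈ L, l.prod ∣ n) →
    (∀ l ∈ L, ∀ l' ∈ L, l <+: l' → l = l') → ∑ l ∈ L, listWeight s l ≤ 1 := by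
  induction n using Nat.strong_induction_on with
  | _ n ih =>
  intro s L hn hs hprime hdvd hfree
  have hlogn : 0 ≤ Real.log n := Real.log_natCast_nonneg n
  by_cases hnil : [] ∈ L
  · have hL : L = {[]} := by
      ext l
      simp only [Finset.mem_singleton]
      exact ⟨fun hl => (hfree [] hnil l hl ⟨l, rfl⟩).symm, fun hl => hl ▸ hnil⟩
    simp [hL, listWeight]
  have hhead : ∀ l ∈ L, l.headI ∈ n.primeFactors := by
    intro l hl
    match l, hl with
    | [], hl => exact absurd hl hnil
    | p :: l, hl =>
      refine Nat.mem_primeFactors.2 ⟨hprime _ hl p (by simp), ?_, hn.ne'⟩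
      exact (Dvd.intro _ (List.prod_cons (a := p) (l := l)).symm).trans (hdvd _ hl)
  rw [← Finset.sum_fiberwise_of_maps_to hhead]
  have key : ∀ p ∈ n.primeFactors,
      ∑ l ∈ L with l.headI = p, listWeight s l ≤ Real.log p / s := by
    intro p hp
    have hpp := Nat.prime_of_mem_primeFactors hp
    have hpn := Nat.dvd_of_mem_primeFactors hp
    have hcons : ∀ l ∈ L.filter (fun l => l.headI = p), l = p :: l.tail := by
      intro l hl
      obtain ⟨hl, hp⟩ := Finset.mem_filter.1 hl
      match l, hl with
      | [], hl => exact absurd hl hnil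
      | q :: l, hl => simpa using hp
    have hinj : Set.InjOn List.tail (L.filter (fun l => l.headI = p) : Set (List ℕ)) := by
      intro l hl l' hl' h
      rw [hcons l hl, hcons l' hl', h]
    have hmem : ∀ l ∈ (L.filter (fun l => l.headI = p)).image List.tail, p :: l ∈ L := by
      intro l hl
      obtain ⟨l', hl', rfl⟩ := Finset.mem_image.1 hl
      rw [← hcons l' hl']
      exact (Finset.mem_filter.1 hl').1
    have hsum : ∑ l ∈ L with l.headI = p, listWeight s l = Real.log p / s *
        ∑ l ∈ (L.filter (fun l => l.headI = p)).image List.tail,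
          listWeight (s - Real.log p) l := by
      rw [Finset.sum_image hinj, Finset.mul_sum]
      refine Finset.sum_congr rfl fun l hl => ?_
      conv_lhs => rw [hcons l hl, listWeight]
    rw [hsum]
    have hlogp : 0 ≤ Real.log p := Real.log_natCast_nonneg p
    refine mul_le_of_le_one_right (div_nonneg hlogp (hlogn.trans hs)) ?_
    refine ih (n / p) (Nat.div_lt_self hn hpp.one_lt) _ _
      (Nat.div_pos (Nat.le_of_dvd hn hpn) hpp.pos) ?_ ?_ ?_ ?_
    · rw [Nat.cast_div hpn (by exact_mod_cast hpp.ne_zero),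
        Real.log_div (by exact_mod_cast hn.ne') (by exact_mod_cast hpp.ne_zero)]
      linarith
    · exact fun l hl q hq => hprime _ (hmem l hl) q (by simp [hq])
    · intro l hl
      have := hdvd _ (hmem l hl)
      rw [List.prod_cons] at this
      exact Nat.dvd_div_of_mul_dvd this
    · intro l hl l' hl' h
      have := hfree _ (hmem l hl) _ (hmem l' hl') (by simpa using h)
      simpa using this
  calc _ ≤ ∑ p ∈ n.primeFactors, Real.log p / s := Finset.sum_le_sum key
    _ = (∑ p ∈ n.primeFactors, Real.log p) / s := by rw [Finset.sum_div]
    _ ≤ s / s := div_le_div_of_nonneg_right ((sum_log_primeFactors_le n hn).trans hs)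
        (hlogn.trans hs)
    _ ≤ 1 := div_self_le_one s

/-- Lower bound for the number of elements of a set which are divisible by the product of some
list in a prefix-free family of lists of primes. -/
lemma sieve_lower_bound (𝒜 : Finset ℕ) (good : ℕ → Prop) (s X : ℝ) (γ : ℕ → ℝ) (D : ℕ)
    (L : Finset (List ℕ)) (hpos : ∀ n ∈ 𝒜, 0 < n) (hlog : ∀ n ∈ 𝒜, Real.log n ≤ s)
    (hprime : ∀ l ∈ L, ∀ p ∈ l, p.Prime)
    (hfree : ∀ l ∈ L, ∀ l' ∈ L, l <+: l' → l = l')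
    (hD : ∀ l ∈ L, l.prod ≤ D) (hs : ∀ l ∈ L, Real.log l.prod ≤ s)
    (hw : ∀ l ∈ L, 0 ≤ listWeight s l)
    (hgood : ∀ l ∈ L, ∀ n ∈ 𝒜, l.prod ∣ n → good n) :
    X * ∑ l ∈ L, listWeight s l * (γ l.prod / l.prod)
      - ∑ d ∈ Finset.Icc 1 D, |((𝒜.filter (fun n => d ∣ n)).card : ℝ) - γ d * X / d|
      ≤ ((𝒜.filter good).card : ℝ) := by
  set E : ℕ → ℝ := fun d => |((𝒜.filter (fun n => d ∣ n)).card : ℝ) - γ d * X / d| with hE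
  have hprod : ∀ l ∈ L, 0 < l.prod := fun l hl =>
    List.prod_pos fun p hp => (hprime l hl p hp).pos
  have hcount : ∑ l ∈ L, listWeight s l * ((𝒜.filter (fun n => l.prod ∣ n)).card : ℝ)
      ≤ ((𝒜.filter good).card : ℝ) := by
    have hswap : ∑ l ∈ L, listWeight s l * ((𝒜.filter (fun n => l.prod ∣ n)).card : ℝ)
        = ∑ n ∈ 𝒜, ∑ l ∈ L with l.prod ∣ n, listWeight s l := by
      simp_rw [Finset.card_filter, Finset.sum_filter]
      push_cast
      simp_rw [Finset.mul_sum]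
      rw [Finset.sum_comm]
      refine Finset.sum_congr rfl fun n _ => Finset.sum_congr rfl fun l _ => ?_
      split_ifs <;> simp
    rw [hswap, Finset.card_filter]
    push_cast
    refine Finset.sum_le_sum fun n hn => ?_
    split_ifs with hg
    · refine sum_listWeight_le_one n s _ (hpos n hn) (hlog n hn) ?_ ?_ ?_
      · exact fun l hl => hprime l (Finset.mem_filter.1 hl).1
      · exact fun l hl => (Finset.mem_filter.1 hl).2
      · exact fun l hl l' hl' =>
          hfree l (Finset.mem_filter.1 hl).1 l' (Finset.mem_filter.1 hl').1
    · refine (Finset.sum_eq_zero fun l hl => ?_).le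
      obtain ⟨hl, hln⟩ := Finset.mem_filter.1 hl
      exact absurd (hgood l hl n hn hln) hg
  have herr : ∑ l ∈ L, listWeight s l * E l.prod ≤ ∑ d ∈ Finset.Icc 1 D, E d := by
    have hmaps : ∀ l ∈ L, l.prod ∈ Finset.Icc 1 D := fun l hl =>
      Finset.mem_Icc.2 ⟨hprod l hl, hD l hl⟩
    rw [← Finset.sum_fiberwise_of_maps_to hmaps]
    refine Finset.sum_le_sum fun d hd => ?_
    have hEd : 0 ≤ E d := abs_nonneg _
    have hfib : ∑ l ∈ L with l.prod = d, listWeight s l * E l.prod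
        = (∑ l ∈ L with l.prod = d, listWeight s l) * E d := by
      rw [Finset.sum_mul]
      refine Finset.sum_congr rfl fun l hl => ?_
      rw [(Finset.mem_filter.1 hl).2]
    rw [hfib]
    by_cases hne : (L.filter (fun l => l.prod = d)).Nonempty
    · obtain ⟨l₀, hl₀⟩ := hne
      obtain ⟨hl₀, hd₀⟩ := Finset.mem_filter.1 hl₀
      refine mul_le_of_le_one_left hEd (sum_listWeight_le_one d s _ (Finset.mem_Icc.1 hd).1
        (hd₀ ▸ hs l₀ hl₀) ?_ ?_ ?_)
      · exact fun l hl => hprime l (Finset.mem_filter.1 hl).1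
      · exact fun l hl => (Finset.mem_filter.1 hl).2.dvd
      · exact fun l hl l' hl' =>
          hfree l (Finset.mem_filter.1 hl).1 l' (Finset.mem_filter.1 hl').1
    · rw [Finset.not_nonempty_iff_eq_empty.1 hne]
      simpa using hEd
  have hterm : X * ∑ l ∈ L, listWeight s l * (γ l.prod / l.prod)
      ≤ ∑ l ∈ L, listWeight s l * ((𝒜.filter (fun n => l.prod ∣ n)).card : ℝ)
        + ∑ l ∈ L, listWeight s l * E l.prod := by
    rw [Finset.mul_sum, ← Finset.sum_add_distrib]
    refine Finset.sum_le_sum fun l hl => ?_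
    have h2 : γ l.prod * X / l.prod
        ≤ ((𝒜.filter (fun n => l.prod ∣ n)).card : ℝ) + E l.prod := by
      have := neg_abs_le (((𝒜.filter (fun n => l.prod ∣ n)).card : ℝ)
        - γ l.prod * X / l.prod)
      simp only [hE]
      linarith
    calc _ = listWeight s l * (γ l.prod * X / l.prod) := by ring
      _ ≤ _ := by
        rw [← mul_add]
        exact mul_le_mul_of_nonneg_left h2 (hw l hl)
  linarith

/-- The half-open cell of index `q` in the regular subdivision of `(0,1]^k` into `N^k` cubes. -/
def gridCell {k N : ℕ} (q : Fin k → Fin N) : Set (Fin k → ℝ) :=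
  Set.univ.pi fun i => Set.Ioc ((q i : ℝ) / N) (((q i : ℝ) + 1) / N)

/-- The step function which takes the infimum of `g` over each cell of the grid. -/
noncomputable def lowerStep {k : ℕ} (g : (Fin k → ℝ) → ℝ) (N : ℕ) (t : Fin k → ℝ) : ℝ :=
  ∑ q : Fin k → Fin N, (gridCell q).indicator (fun _ => sInf (g '' gridCell q)) t

lemma mem_gridCell {k N : ℕ} (hN : 0 < N) (q : Fin k → Fin N) (t : Fin k → ℝ) :
    t ∈ gridCell q ↔ ∀ i, ⌈(N : ℝ) * t i⌉ = (q i : ℤ) + 1 := by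
  have hN' : (0 : ℝ) < N := by exact_mod_cast hN
  simp only [gridCell, Set.mem_univ_pi, Set.mem_Ioc]
  refine forall_congr' fun i => ?_
  rw [Int.ceil_eq_iff, div_lt_iff₀ hN', le_div_iff₀ hN']
  push_cast
  constructor <;> rintro ⟨h1, h2⟩ <;> constructor <;> linarith

lemma measurableSet_gridCell {k N : ℕ} (q : Fin k → Fin N) : MeasurableSet (gridCell q) :=
  MeasurableSet.univ_pi fun _ => measurableSet_Ioc

lemma lowerStep_eq {k N : ℕ} (hN : 0 < N) (g : (Fin k → ℝ) → ℝ) (q : Fin k → Fin N)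
    (t : Fin k → ℝ) (ht : t ∈ gridCell q) : lowerStep g N t = sInf (g '' gridCell q) := by
  rw [lowerStep, Finset.sum_eq_single q]
  · rw [Set.indicator_of_mem ht]
  · intro q' _ hq'
    refine Set.indicator_of_notMem (fun ht' => hq' ?_) _
    rw [mem_gridCell hN] at ht ht'
    ext i
    have := (ht i).symm.trans (ht' i)
    omega
  · simp

lemma lowerStep_eq_zero {k N : ℕ} (g : (Fin k → ℝ) → ℝ) (t : Fin k → ℝ)
    (ht : ∀ q : Fin k → Fin N, t ∉ gridCell q) : lowerStep g N t = 0 :=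
  Finset.sum_eq_zero fun q _ => Set.indicator_of_notMem (ht q) _

lemma bddBelow_image_of_nonneg {k : ℕ} {g : (Fin k → ℝ) → ℝ} (h0 : ∀ t, 0 ≤ g t)
    (S : Set (Fin k → ℝ)) : BddBelow (g '' S) :=
  ⟨0, by rintro _ ⟨t, _, rfl⟩; exact h0 t⟩

lemma lowerStep_nonneg {k N : ℕ} {g : (Fin k → ℝ) → ℝ} (h0 : ∀ t, 0 ≤ g t)
    (t : Fin k → ℝ) : 0 ≤ lowerStep g N t :=
  Finset.sum_nonneg fun _ _ => Set.indicator_nonneg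
    (fun _ _ => Real.sInf_nonneg (by rintro _ ⟨t, _, rfl⟩; exact h0 t)) t

lemma lowerStep_le {k N : ℕ} (hN : 0 < N) {g : (Fin k → ℝ) → ℝ} (h0 : ∀ t, 0 ≤ g t)
    (t : Fin k → ℝ) : lowerStep g N t ≤ g t := by
  by_cases h : ∃ q : Fin k → Fin N, t ∈ gridCell q
  · obtain ⟨q, hq⟩ := h
    rw [lowerStep_eq hN g q t hq]
    exact csInf_le (bddBelow_image_of_nonneg h0 _) ⟨t, hq, rfl⟩
  · push Not at h
    rw [lowerStep_eq_zero g t h]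
    exact h0 t

lemma exists_mem_gridCell {k N : ℕ} (hN : 0 < N) (t : Fin k → ℝ)
    (ht : ∀ i, t i ∈ Set.Ioo (0 : ℝ) 1) : ∃ q : Fin k → Fin N, t ∈ gridCell q := by
  have hN' : (0 : ℝ) < N := by exact_mod_cast hN
  have h1 : ∀ i, 0 < ⌈(N : ℝ) * t i⌉ := fun i => Int.ceil_pos.2 (mul_pos hN' (ht i).1)
  have h2 : ∀ i, ⌈(N : ℝ) * t i⌉ ≤ N := fun i => Int.ceil_le.2 (by
    push_cast
    exact mul_le_of_le_one_right hN'.le (ht i).2.le)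
  refine ⟨fun i => ⟨(⌈(N : ℝ) * t i⌉ - 1).toNat, ?_⟩, ?_⟩
  · have := h1 i
    have := h2 i
    omega
  · rw [mem_gridCell hN]
    intro i
    have := h1 i
    simp only
    omega

lemma dist_lt_of_mem_gridCell {k N : ℕ} (hN : 0 < N) {q : Fin k → Fin N} {t s : Fin k → ℝ}
    (ht : t ∈ gridCell q) (hs : s ∈ gridCell q) {r : ℝ} (hr : 1 / (N : ℝ) < r) :
    dist s t < r := by
  have hN' : (0 : ℝ) < N := by exact_mod_cast hN
  refine (dist_pi_lt_iff (lt_trans (by positivity) hr)).2 fun i => lt_of_le_of_lt ?_ hr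
  have h1 := ht i (Set.mem_univ i)
  have h2 := hs i (Set.mem_univ i)
  simp only [Set.mem_Ioc, add_div] at h1 h2
  rw [Real.dist_eq, abs_le]
  constructor <;> linarith [h1.1, h1.2, h2.1, h2.2]

lemma tendsto_lowerStep {k : ℕ} {g : (Fin k → ℝ) → ℝ} (hg : LowerSemicontinuous g)
    (h0 : ∀ t, 0 ≤ g t) (hsupp : ∀ t, g t ≠ 0 → ∀ i, t i ∈ Set.Ioo (0 : ℝ) 1)
    (t : Fin k → ℝ) :
    Filter.Tendsto (fun n : ℕ => lowerStep g (n + 1) t) Filter.atTop (nhds (g t)) := by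
  rw [tendsto_order]
  constructor
  · intro a ha
    by_cases hgt : g t = 0
    · exact Filter.Eventually.of_forall fun n =>
        lt_of_lt_of_le (hgt ▸ ha) (lowerStep_nonneg h0 t)
    obtain ⟨b, hab, hb⟩ := exists_between ha
    obtain ⟨r, hr, hball⟩ := Metric.eventually_nhds_iff.1 (hg t b hb)
    filter_upwards [(tendsto_one_div_add_atTop_nhds_zero_nat (𝕜 := ℝ)).eventually_lt_const hr]
      with n hn
    obtain ⟨q, hq⟩ := exists_mem_gridCell (Nat.succ_pos n) t (hsupp t hgt)
    rw [lowerStep_eq (Nat.succ_pos n) g q t hq]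
    refine lt_of_lt_of_le hab (le_csInf ⟨_, t, hq, rfl⟩ ?_)
    rintro _ ⟨s, hs, rfl⟩
    exact (hball (dist_lt_of_mem_gridCell (Nat.succ_pos n) hq hs (by push_cast; exact hn))).le
  · exact fun a ha => Filter.Eventually.of_forall fun n =>
      lt_of_le_of_lt (lowerStep_le (Nat.succ_pos n) h0 t) ha

lemma volume_real_gridCell {k N : ℕ} (q : Fin k → Fin N) :
    volume.real (gridCell q) = (1 / (N : ℝ)) ^ k := by
  rw [measureReal_def, gridCell, Real.volume_pi_Ioc_toReal]
  · simp [add_div]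
  · intro i
    simp only
    gcongr
    linarith

lemma volume_gridCell_ne_top {k N : ℕ} (q : Fin k → Fin N) : volume (gridCell q) ≠ ⊤ := by
  rw [gridCell, Real.volume_pi_Ioc]
  exact (ENNReal.prod_lt_top fun _ _ => ENNReal.ofReal_lt_top).ne

lemma integrable_lowerStep {k : ℕ} (g : (Fin k → ℝ) → ℝ) (N : ℕ) :
    Integrable (lowerStep g N) := by
  refine integrable_finsetSum _ fun q _ => ?_
  exact (integrable_indicator_iff (measurableSet_gridCell q)).2
    (integrableOn_const (volume_gridCell_ne_top q))

lemma integral_lowerStep {k : ℕ} (g : (Fin k → ℝ) → ℝ) (N : ℕ) :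
    ∫ t, lowerStep g N t = ∑ q : Fin k → Fin N, sInf (g '' gridCell q) * (1 / (N : ℝ)) ^ k := by
  unfold lowerStep
  rw [integral_finsetSum]
  · refine Finset.sum_congr rfl fun q _ => ?_
    rw [integral_indicator_const _ (measurableSet_gridCell q), volume_real_gridCell,
      smul_eq_mul, mul_comm]
  · exact fun q _ => (integrable_indicator_iff (measurableSet_gridCell q)).2
      (integrableOn_const (volume_gridCell_ne_top q))

lemma tendsto_integral_lowerStep {k : ℕ} {g : (Fin k → ℝ) → ℝ} (hg : LowerSemicontinuous g)
    (h0 : ∀ t, 0 ≤ g t) (h1 : ∀ t, g t ≤ 1)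
    (hsupp : ∀ t, g t ≠ 0 → ∀ i, t i ∈ Set.Ioo (0 : ℝ) 1) :
    Filter.Tendsto (fun n : ℕ => ∫ t, lowerStep g (n + 1) t) Filter.atTop
      (nhds (∫ t, g t)) := by
  refine tendsto_integral_of_dominated_convergence
    ((Set.univ.pi fun _ : Fin k => Set.Ioo (0 : ℝ) 1).indicator fun _ => 1)
    (fun n => (integrable_lowerStep g _).aestronglyMeasurable) ?_ ?_ ?_
  · refine (integrable_indicator_iff (MeasurableSet.univ_pi fun _ => measurableSet_Ioo)).2
      (integrableOn_const ?_)
    rw [Real.volume_pi_Ioo]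
    exact (ENNReal.prod_lt_top fun _ _ => ENNReal.ofReal_lt_top).ne
  · refine fun n => Filter.Eventually.of_forall fun t => ?_
    rw [Real.norm_of_nonneg (lowerStep_nonneg h0 t)]
    refine (lowerStep_le (Nat.succ_pos n) h0 t).trans ?_
    by_cases ht : g t = 0
    · rw [ht]
      exact Set.indicator_nonneg (fun _ _ => zero_le_one) t
    · rw [Set.indicator_of_mem (by simpa using hsupp t ht)]
      exact h1 t
  · exact Filter.Eventually.of_forall fun t => tendsto_lowerStep hg h0 hsupp t

/-- Comparison of a multiple sum over a weighted finite set with a multiple integral, when the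
weighted set is close to `κ` times the Lebesgue measure on `(0,1]`. -/
lemma eventually_integral_le_sum {k : ℕ} {g : (Fin k → ℝ) → ℝ} (hg : LowerSemicontinuous g)
    (h0 : ∀ t, 0 ≤ g t) (h1 : ∀ t, g t ≤ 1)
    (hsupp : ∀ t, g t ≠ 0 → ∀ i, t i ∈ Set.Ioo (0 : ℝ) 1) {κ ε : ℝ} (hκ : 0 < κ)
    (hε : 0 < ε) :
    ∀ᶠ η in nhds (0 : ℝ), ∀ (P : Finset ℕ) (m τ : ℕ → ℝ), (∀ p ∈ P, 0 ≤ m p) →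
      (∀ a b : ℝ, 0 ≤ a → a ≤ b → b ≤ 1 →
        κ * (b - a) - η ≤ ∑ p ∈ P with a < τ p ∧ τ p ≤ b, m p) →
      κ ^ k * (∫ t, g t) - ε
        ≤ ∑ p ∈ Fintype.piFinset (fun _ : Fin k => P), g (fun i => τ (p i)) * ∏ i, m (p i) := by
  have hlim := ((tendsto_integral_lowerStep hg h0 h1 hsupp).const_mul (κ ^ k)).eventually_const_lt
    (sub_lt_self _ hε)
  obtain ⟨n, hn⟩ := hlim.exists
  set N := n + 1 with hNdef
  have hN : 0 < N := Nat.succ_pos n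
  have hN' : (0 : ℝ) < N := by exact_mod_cast hN
  have hcont : Filter.Tendsto (fun η : ℝ => (κ - N * η) ^ k * ∫ t, lowerStep g N t) (nhds 0)
      (nhds (κ ^ k * ∫ t, lowerStep g N t)) := by
    have : Continuous fun η : ℝ => (κ - N * η) ^ k * ∫ t, lowerStep g N t := by fun_prop
    simpa using this.tendsto 0
  have hpos : ∀ᶠ η in nhds (0 : ℝ), 0 < κ - N * η := by
    have : Continuous fun η : ℝ => κ - N * η := by fun_prop
    have h := this.tendsto 0
    simp only [mul_zero, sub_zero] at h
    exact h.eventually_const_lt hκ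
  filter_upwards [hcont.eventually_const_lt hn, hpos] with η hη hηpos P m τ hm hdisc
  refine hη.le.trans ?_
  have hmprod : ∀ p ∈ Fintype.piFinset (fun _ : Fin k => P), 0 ≤ ∏ i, m (p i) := fun p hp =>
    Finset.prod_nonneg fun i _ => hm _ (Fintype.mem_piFinset.1 hp i)
  calc (κ - N * η) ^ k * ∫ t, lowerStep g N t
      = ∑ q : Fin k → Fin N, sInf (g '' gridCell q) * ∏ _i : Fin k, (κ / N - η) := by
        rw [integral_lowerStep, Finset.mul_sum]
        refine Finset.sum_congr rfl fun q _ => ?_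
        rw [Finset.prod_const, Finset.card_univ, Fintype.card_fin, mul_left_comm, ← mul_pow]
        congr 2
        field_simp
    _ ≤ ∑ q : Fin k → Fin N, sInf (g '' gridCell q) * ∏ i : Fin k,
          ∑ p ∈ P with (q i : ℝ) / N < τ p ∧ τ p ≤ ((q i : ℝ) + 1) / N, m p := by
        refine Finset.sum_le_sum fun q _ => mul_le_mul_of_nonneg_left ?_
          (Real.sInf_nonneg (by rintro _ ⟨t, _, rfl⟩; exact h0 t))
        refine Finset.prod_le_prod (fun i _ => ?_) fun i _ => ?_
        · rw [sub_nonneg, le_div_iff₀ hN']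
          linarith
        · have hqi : (q i : ℝ) + 1 ≤ N := by exact_mod_cast (q i).2
          have := hdisc ((q i : ℝ) / N) (((q i : ℝ) + 1) / N) (by positivity)
            (by gcongr; linarith) (by rwa [div_le_one hN'])
          refine le_trans (le_of_eq ?_) this
          ring
    _ = ∑ p ∈ Fintype.piFinset (fun _ : Fin k => P),
          lowerStep g N (fun i => τ (p i)) * ∏ i, m (p i) := by
        simp only [lowerStep, Finset.sum_mul]
        rw [Finset.sum_comm]
        refine Finset.sum_congr rfl fun q _ => ?_
        simp_rw [Finset.sum_filter]
        rw [Finset.prod_univ_sum, Finset.mul_sum]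
        refine Finset.sum_congr rfl fun p _ => ?_
        by_cases hp : (fun i => τ (p i)) ∈ gridCell q
        · rw [Set.indicator_of_mem hp]
          congr 1
          refine Finset.prod_congr rfl fun i _ => if_pos ?_
          simpa using hp i (Set.mem_univ i)
        · rw [Set.indicator_of_notMem hp, zero_mul]
          obtain ⟨i, hi⟩ : ∃ i, ¬ ((q i : ℝ) / N < τ (p i) ∧ τ (p i) ≤ ((q i : ℝ) + 1) / N) := by
            by_contra! h
            exact hp fun i _ => by simpa using h i
          rw [Finset.prod_eq_zero (Finset.mem_univ i) (if_neg hi), mul_zero]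
    _ ≤ _ := Finset.sum_le_sum fun p hp =>
        mul_le_mul_of_nonneg_right (lowerStep_le hN h0 _) (hmprod p hp)

/-- The kernel `∏ᵢ 1 / (u - ∑_{j < i} tⱼ)`. -/
noncomputable def prefixKernel {k : ℕ} (u : ℝ) (t : Fin k → ℝ) : ℝ :=
  ∏ i, (u - ∑ j ∈ Finset.univ.filter (fun j => j < i), t j)⁻¹

/-- The part of `(0,1)^(m+1)` made of vectors with distinct coordinates whose first nonempty
partial sum exceeding `u - 1` is the full sum, which is less than `w`. -/
def stoppedRegion (m : ℕ) (u w : ℝ) : Set (Fin (m + 1) → ℝ) :=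
  {t | (∀ i, t i ∈ Set.Ioo (0 : ℝ) 1) ∧ (∀ i j, i ≠ j → t i ≠ t j) ∧
    (m = 0 ∨ ∑ i : Fin m, t i.castSucc < u - 1) ∧ u - 1 < ∑ i, t i ∧ ∑ i, t i < w}

lemma isOpen_stoppedRegion (m : ℕ) (u w : ℝ) : IsOpen (stoppedRegion m u w) := by
  simp only [stoppedRegion, Set.ofPred_and]
  refine IsOpen.inter ?_ (IsOpen.inter ?_ (IsOpen.inter ?_ (IsOpen.inter ?_ ?_)))
  · simp only [Set.ofPred_forall]
    exact isOpen_iInter_of_finite fun i => isOpen_Ioo.preimage (continuous_apply i)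
  · simp only [Set.ofPred_forall]
    exact isOpen_iInter_of_finite fun i => isOpen_iInter_of_finite fun j =>
      isOpen_iInter_of_finite fun _ =>
        isOpen_ne_fun (continuous_apply i) (continuous_apply j)
  · rw [Set.ofPred_or]
    exact isOpen_const.union (isOpen_lt (by fun_prop) continuous_const)
  · exact isOpen_lt continuous_const (by fun_prop)
  · exact isOpen_lt (by fun_prop) continuous_const

lemma one_le_sub_partialSum {m : ℕ} {u w : ℝ} (hu : 1 ≤ u) {t : Fin (m + 1) → ℝ}
    (ht : t ∈ stoppedRegion m u w) (i : Fin (m + 1)) :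
    1 ≤ u - ∑ j ∈ Finset.univ.filter (fun j => j < i), t j := by
  obtain ⟨h01, -, hpre, -, -⟩ := ht
  rcases hpre with rfl | hpre
  · have : (Finset.univ.filter fun j : Fin 1 => j < i) = ∅ := by
      ext j
      simp [Subsingleton.elim j i]
    simpa [this] using hu
  · have hle : ∑ j ∈ Finset.univ.filter (fun j => j < i), t j ≤ ∑ j : Fin m, t j.castSucc := by
      rw [Finset.sum_filter, Fin.sum_univ_castSucc, if_neg (not_lt.2 (Fin.le_last i)), add_zero]
      refine Finset.sum_le_sum fun j _ => ?_
      split_ifs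
      · exact le_rfl
      · exact (h01 _).1.le
    linarith

lemma prefixKernel_nonneg {m : ℕ} {u w : ℝ} (hu : 1 ≤ u) {t : Fin (m + 1) → ℝ}
    (ht : t ∈ stoppedRegion m u w) : 0 ≤ prefixKernel u t :=
  Finset.prod_nonneg fun i _ => inv_nonneg.2 (zero_le_one.trans (one_le_sub_partialSum hu ht i))

lemma prefixKernel_le_one {m : ℕ} {u w : ℝ} (hu : 1 ≤ u) {t : Fin (m + 1) → ℝ}
    (ht : t ∈ stoppedRegion m u w) : prefixKernel u t ≤ 1 :=
  Finset.prod_le_one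
    (fun i _ => inv_nonneg.2 (zero_le_one.trans (one_le_sub_partialSum hu ht i)))
    fun i _ => inv_le_one_of_one_le₀ (one_le_sub_partialSum hu ht i)

lemma continuousAt_prefixKernel {m : ℕ} {u w : ℝ} (hu : 1 ≤ u) {t : Fin (m + 1) → ℝ}
    (ht : t ∈ stoppedRegion m u w) : ContinuousAt (prefixKernel u) t := by
  unfold prefixKernel
  refine tendsto_finsetProd _ fun i _ => ?_
  refine ContinuousAt.inv₀ (Continuous.continuousAt (by fun_prop)) ?_
  exact (zero_lt_one.trans_le (one_le_sub_partialSum hu ht i)).ne'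

lemma indicator_prefixKernel_nonneg {m : ℕ} {u : ℝ} (w : ℝ) (hu : 1 ≤ u)
    (t : Fin (m + 1) → ℝ) : 0 ≤ (stoppedRegion m u w).indicator (prefixKernel u) t :=
  Set.indicator_nonneg (fun _ ht => prefixKernel_nonneg hu ht) t

lemma indicator_prefixKernel_le_one {m : ℕ} {u : ℝ} (w : ℝ) (hu : 1 ≤ u)
    (t : Fin (m + 1) → ℝ) : (stoppedRegion m u w).indicator (prefixKernel u) t ≤ 1 :=
  Set.indicator_le' (fun _ ht => prefixKernel_le_one hu ht) (fun _ _ => zero_le_one) t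

lemma lowerSemicontinuous_indicator_prefixKernel (m : ℕ) {u : ℝ} (w : ℝ) (hu : 1 ≤ u) :
    LowerSemicontinuous ((stoppedRegion m u w).indicator (prefixKernel u)) := by
  intro t
  by_cases ht : t ∈ stoppedRegion m u w
  · refine ContinuousAt.lowerSemicontinuousAt ?_
    refine (continuousAt_prefixKernel hu ht).congr ?_
    filter_upwards [(isOpen_stoppedRegion m u w).mem_nhds ht] with s hs
    rw [Set.indicator_of_mem hs]
  · intro a ha
    rw [Set.indicator_of_notMem ht] at ha
    exact Filter.Eventually.of_forall fun s =>
      ha.trans_le (indicator_prefixKernel_nonneg w hu s)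

lemma prefixKernel_succ {m : ℕ} (u : ℝ) (t : Fin (m + 1) → ℝ) :
    prefixKernel u t = u⁻¹ *
      ∏ j ∈ Finset.univ.filter (fun j : Fin (m + 1) => (j : ℕ) < m + 1 - 1),
        (u - ∑ i ∈ Finset.univ.filter (fun i : Fin (m + 1) => i ≤ j), t i)⁻¹ := by
  rw [prefixKernel, Fin.prod_univ_succ, Finset.prod_filter, Fin.prod_univ_castSucc]
  have hle : ∀ i : Fin m, (Finset.univ.filter fun j : Fin (m + 1) => j < i.succ)
      = Finset.univ.filter fun j : Fin (m + 1) => j ≤ i.castSucc := by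
    intro i
    ext j
    simp only [Finset.mem_filter, Finset.mem_univ, true_and, Fin.lt_def, Fin.le_def,
      Fin.val_succ, Fin.val_castSucc]
    omega
  simp [hle]

lemma ae_injective_pi (k : ℕ) : ∀ᵐ t : Fin k → ℝ, ∀ i j, i ≠ j → t i ≠ t j := by
  simp only [ae_all_iff]
  intro i j hij
  let S : Submodule ℝ (Fin k → ℝ) :=
    LinearMap.ker (LinearMap.proj (R := ℝ) (φ := fun _ : Fin k => ℝ) i - LinearMap.proj j)
  have hS : S ≠ ⊤ := by
    intro h
    have hmem : Pi.single i (1 : ℝ) ∈ S := h ▸ Submodule.mem_top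
    simp [S, hij.symm] at hmem
  have hvol := Measure.addHaar_submodule volume S hS
  rw [ae_iff]
  convert hvol using 2
  ext t
  simp [S, sub_eq_zero]

lemma sum_filter_lt_last {m : ℕ} (t : Fin (m + 1) → ℝ) :
    ∑ i ∈ Finset.univ.filter (fun i : Fin (m + 1) => (i : ℕ) < m + 1 - 1), t i
      = ∑ i : Fin m, t i.castSucc := by
  rw [Finset.sum_filter, Fin.sum_univ_castSucc]
  simp

lemma integral_indicator_prefixKernel (m : ℕ) (u v : ℝ) :
    ∫ t, (stoppedRegion m u (u - v)).indicator (prefixKernel u) t = muk (m + 1) u v := by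
  rw [integral_indicator (isOpen_stoppedRegion m u _).measurableSet]
  by_cases hm : m = 0
  · subst hm
    have hker : ∀ t : Fin 1 → ℝ, prefixKernel u t = u⁻¹ := by
      intro t
      rw [prefixKernel_succ]
      simp
    have hreg : stoppedRegion 0 u (u - v) = (MeasurableEquiv.funUnique (Fin 1) ℝ) ⁻¹'
        (Set.Ioo (0:ℝ) 1 ∩ Set.Ioo (u-1) (u-v)) := by
      ext t
      simp [stoppedRegion, MeasurableEquiv.funUnique, Subsingleton.elim _ (0 : Fin 1)]
    simp only [hker, muk, zero_add, if_true, setIntegral_const, smul_eq_mul, measureReal_def]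
    have hvol : volume (stoppedRegion 0 u (u - v))
        = volume (Set.Ioo (0:ℝ) 1 ∩ Set.Ioo (u-1) (u-v)) := by
      rw [hreg, ← (volume_preserving_funUnique (Fin 1) ℝ).measure_preimage_equiv]
      convert rfl
    rw [hvol, mul_comm]
  · rw [muk, if_neg (by omega), ← integral_const_mul]
    simp only [← prefixKernel_succ]
    refine setIntegral_congr_set ?_
    filter_upwards [ae_injective_pi (m + 1)] with t ht
    refine propext ?_
    change t ∈ stoppedRegion m u (u - v) ↔ t ∈ Vk (m + 1) u v
    simp only [stoppedRegion, Vk, Set.mem_ofPred_eq, sum_filter_lt_last, hm, false_or]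
    tauto

lemma listWeight_ofFn {k : ℕ} (s : ℝ) (p : Fin k → ℕ) :
    listWeight s (List.ofFn p) = ∏ i, Real.log (p i) /
      (s - ∑ j ∈ Finset.univ.filter (fun j => j < i), Real.log (p j)) := by
  induction k generalizing s with
  | zero => simp [listWeight]
  | succ k ih =>
    rw [List.ofFn_succ, listWeight, ih, Fin.prod_univ_succ]
    congr 1
    · simp
    · refine Finset.prod_congr rfl fun i _ => ?_
      congr 1
      simp only [Finset.sum_filter, Fin.sum_univ_succ (n := k), Fin.succ_pos, if_true,
        Fin.succ_lt_succ_iff]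
      ring

lemma listWeight_ofFn_eq_prefixKernel {k : ℕ} {u ℓ : ℝ} (hℓ : 0 < ℓ) (p : Fin k → ℕ) :
    listWeight (u * ℓ) (List.ofFn p) =
      prefixKernel u (fun i => Real.log (p i) / ℓ) * ∏ i, (Real.log (p i) / ℓ) := by
  rw [listWeight_ofFn, prefixKernel, ← Finset.prod_mul_distrib]
  refine Finset.prod_congr rfl fun i _ => ?_
  rw [← Finset.sum_div]
  have : u - (∑ j ∈ Finset.univ.filter (fun j => j < i), Real.log (p j)) / ℓ
      = (u * ℓ - ∑ j ∈ Finset.univ.filter (fun j => j < i), Real.log (p j)) / ℓ := by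
    field_simp
  rw [this, inv_div, div_mul_div_comm, mul_comm _ ℓ, mul_comm _ ℓ,
    mul_div_mul_left _ _ hℓ.ne']

lemma map_prod_of_multiplicative {γ : ℕ → ℝ} (h1 : γ 1 = 1)
    (hmul : ∀ m n : ℕ, 0 < m → 0 < n → Nat.Coprime m n → γ (m * n) = γ m * γ n)
    {k : ℕ} (p : Fin k → ℕ) (hp : ∀ i, (p i).Prime) (hinj : ∀ i j, i ≠ j → p i ≠ p j) :
    γ (∏ i, p i) = ∏ i, γ (p i) := by
  induction (Finset.univ : Finset (Fin k)) using Finset.induction_on with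
  | empty => simpa using h1
  | insert a s ha ih =>
    rw [Finset.prod_insert ha, Finset.prod_insert ha, hmul _ _ (hp a).pos
      (Finset.prod_pos fun i _ => (hp i).pos), ih]
    refine Nat.Coprime.prod_right fun i hi => (Nat.coprime_primes (hp a) (hp i)).2 (hinj a i ?_)
    rintro rfl
    exact ha hi

/-- The primes up to `y`. -/
noncomputable def primesLE (y : ℝ) : Finset ℕ := (Finset.range (⌊y⌋₊ + 1)).filter Nat.Prime

lemma prime_of_mem_primesLE {y : ℝ} {p : ℕ} (hp : p ∈ primesLE y) : p.Prime :=
  (Finset.mem_filter.1 hp).2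

lemma filter_primesLE_eq {y t : ℝ} (hy : 1 < y) (ht : t ≤ 1) :
    (primesLE y).filter (fun p : ℕ => Real.log p / Real.log y ≤ t) = primesLE (y ^ t) := by
  have hy0 : 0 < y := zero_lt_one.trans hy
  have hlog : 0 < Real.log y := Real.log_pos hy
  ext p
  simp only [primesLE, Finset.mem_filter, Finset.mem_range, Nat.lt_succ_iff]
  have hle : p.Prime → (Real.log p / Real.log y ≤ t ↔ p ≤ ⌊y ^ t⌋₊) := by
    intro hp
    have hp0 : (0 : ℝ) < p := by exact_mod_cast hp.pos
    rw [Nat.le_floor_iff (Real.rpow_nonneg hy0.le t), div_le_iff₀ hlog,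
      ← Real.log_rpow hy0, Real.log_le_log_iff hp0 (Real.rpow_pos_of_pos hy0 t)]
  have hmono : ⌊y ^ t⌋₊ ≤ ⌊y⌋₊ := Nat.floor_mono (by
    simpa using Real.rpow_le_rpow_of_exponent_le hy.le ht)
  constructor
  · rintro ⟨⟨_, hp⟩, h⟩
    exact ⟨(hle hp).1 h, hp⟩
  · rintro ⟨h, hp⟩
    exact ⟨⟨h.trans hmono, hp⟩, (hle hp).2 h⟩

lemma abs_sum_primesLE_sub_le {γ : ℕ → ℝ} {κ A z : ℝ} (hκ : 0 < κ) (hA : 0 ≤ A)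
    (hγ : ∀ z : ℝ, 2 ≤ z → |(∑ p ∈ primesLE z, γ p * Real.log p / p) - κ * Real.log z| ≤ A)
    (hz : 1 ≤ z) :
    |(∑ p ∈ primesLE z, γ p * Real.log p / p) - κ * Real.log z| ≤ A + κ * Real.log 2 := by
  have hlog2 : 0 < κ * Real.log 2 := mul_pos hκ (Real.log_pos one_lt_two)
  rcases le_or_gt 2 z with h | h
  · linarith [hγ z h]
  · have hempty : primesLE z = ∅ := by
      refine Finset.eq_empty_of_forall_notMem fun p hp => ?_
      obtain ⟨hpz, hp⟩ := Finset.mem_filter.1 hp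
      have hfl : ⌊z⌋₊ < 2 := Nat.floor_lt' two_ne_zero |>.2 (by exact_mod_cast h)
      have := hp.two_le
      rw [Finset.mem_range] at hpz
      omega
    rw [hempty, Finset.sum_empty, zero_sub, abs_neg,
      abs_of_nonneg (mul_nonneg hκ.le (Real.log_nonneg hz))]
    have := mul_le_mul_of_nonneg_left (Real.log_le_log (by linarith) h.le) hκ.le
    linarith

lemma le_sum_primesLE_interval {γ : ℕ → ℝ} {κ A y : ℝ} (hκ : 0 < κ) (hA : 0 ≤ A) (hy : 1 < y)
    (hγ : ∀ z : ℝ, 2 ≤ z → |(∑ p ∈ primesLE z, γ p * Real.log p / p) - κ * Real.log z| ≤ A)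
    (a b : ℝ) (ha : 0 ≤ a) (hab : a ≤ b) (hb : b ≤ 1) :
    κ * (b - a) - 2 * (A + κ * Real.log 2) / Real.log y
      ≤ ∑ p ∈ (primesLE y).filter
            (fun p : ℕ => a < Real.log p / Real.log y ∧ Real.log p / Real.log y ≤ b),
          γ p * Real.log p / p / Real.log y := by
  have hy0 : 0 < y := zero_lt_one.trans hy
  have hlog : 0 < Real.log y := Real.log_pos hy
  have hcum : ∀ t : ℝ, 0 ≤ t → t ≤ 1 →
      |(∑ p ∈ (primesLE y).filter (fun p : ℕ => Real.log p / Real.log y ≤ t),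
          γ p * Real.log p / p)
        - κ * (t * Real.log y)| ≤ A + κ * Real.log 2 := by
    intro t ht0 ht1
    rw [filter_primesLE_eq hy ht1, ← Real.log_rpow hy0]
    exact abs_sum_primesLE_sub_le hκ hA hγ (Real.one_le_rpow hy.le ht0)
  have hsplit :
      (∑ p ∈ (primesLE y).filter (fun p : ℕ => Real.log p / Real.log y ≤ a),
          γ p * Real.log p / p)
      + ∑ p ∈ (primesLE y).filter
            (fun p : ℕ => a < Real.log p / Real.log y ∧ Real.log p / Real.log y ≤ b),
          γ p * Real.log p / p
      = ∑ p ∈ (primesLE y).filter (fun p : ℕ => Real.log p / Real.log y ≤ b),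
          γ p * Real.log p / p := by
    simp only [Finset.sum_filter]
    rw [← Finset.sum_add_distrib]
    refine Finset.sum_congr rfl fun p _ => ?_
    by_cases h1 : Real.log p / Real.log y ≤ a
    · simp [h1, not_lt.2 h1, h1.trans hab]
    · simp [h1, not_le.1 h1]
  have hA' := (abs_le.1 (hcum a ha (hab.trans hb))).2
  have hB' := (abs_le.1 (hcum b (ha.trans hab) hb)).1
  rw [← Finset.sum_div, le_div_iff₀ hlog, sub_mul, div_mul_cancel₀ _ hlog.ne']
  linarith

/-- Tuples of primes up to `y` whose normalised logarithms lie in the stopped region. -/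
noncomputable def primeTuples (y u w : ℝ) (m : ℕ) : Finset (Fin (m + 1) → ℕ) :=
  (Fintype.piFinset fun _ => primesLE y).filter
    fun p => (fun i => Real.log (p i) / Real.log y) ∈ stoppedRegion m u w

/-- The lists of at most `K` primes given by `primeTuples`. -/
noncomputable def primeLists (y u w : ℝ) (K : ℕ) : Finset (List ℕ) :=
  (Finset.range K).biUnion fun m => (primeTuples y u w m).image List.ofFn

lemma mem_primeTuples {y u w : ℝ} {m : ℕ} {p : Fin (m + 1) → ℕ} :
    p ∈ primeTuples y u w m ↔ (∀ i, p i ∈ primesLE y) ∧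
      (fun i => Real.log (p i) / Real.log y) ∈ stoppedRegion m u w := by
  rw [primeTuples, Finset.mem_filter, Fintype.mem_piFinset]

lemma mem_primeLists {y u w : ℝ} {K : ℕ} {l : List ℕ} :
    l ∈ primeLists y u w K ↔ ∃ m < K, ∃ p ∈ primeTuples y u w m, List.ofFn p = l := by
  simp [primeLists]

lemma eq_of_prefix_of_mem_stoppedRegion {m m' : ℕ} {u w ℓ : ℝ} (hℓ : 0 < ℓ)
    {p : Fin (m + 1) → ℕ} {p' : Fin (m' + 1) → ℕ}
    (hp : (fun i => Real.log (p i) / ℓ) ∈ stoppedRegion m u w)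
    (hp' : (fun i => Real.log (p' i) / ℓ) ∈ stoppedRegion m' u w)
    (h : List.ofFn p <+: List.ofFn p') : List.ofFn p = List.ofFn p' := by
  obtain ⟨r, hr⟩ := h
  by_cases hnil : r = []
  · rw [← hr, hnil, List.append_nil]
  exfalso
  have hdrop : List.ofFn p ++ r.dropLast = List.ofFn fun i : Fin m' => p' i.castSucc := by
    rw [← List.dropLast_append_of_ne_nil hnil, hr, List.ofFn_succ', List.concat_eq_append,
      List.dropLast_concat]
  have hsum := congrArg (fun l => (l.map fun q : ℕ => Real.log q / ℓ).sum) hdrop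
  simp only [List.map_append, List.sum_append, List.map_ofFn, List.sum_ofFn,
    Function.comp_def] at hsum
  have hlen := congrArg List.length hdrop
  simp only [List.length_append, List.length_ofFn] at hlen
  have hnonneg : 0 ≤ (r.dropLast.map fun q : ℕ => Real.log q / ℓ).sum := by
    refine List.sum_nonneg fun a ha => ?_
    obtain ⟨q, -, rfl⟩ := List.mem_map.1 ha
    exact div_nonneg (Real.log_natCast_nonneg q) hℓ.le
  obtain ⟨-, -, -, h1, -⟩ := hp
  obtain ⟨-, -, h2, -, -⟩ := hp'
  rcases h2 with h2 | h2
  · omega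
  · linarith

lemma log_prod_ofFn {k : ℕ} (p : Fin k → ℕ) (hp : ∀ i, (p i).Prime) :
    Real.log ((List.ofFn p).prod : ℕ) = ∑ i, Real.log (p i) := by
  rw [List.prod_ofFn, Nat.cast_prod, Real.log_prod]
  exact fun i _ => by exact_mod_cast (hp i).ne_zero

lemma sum_primeLists_eq {γ : ℕ → ℝ} (h1 : γ 1 = 1)
    (hmul : ∀ m n : ℕ, 0 < m → 0 < n → Nat.Coprime m n → γ (m * n) = γ m * γ n)
    {y u w : ℝ} (hy : 1 < y) (K : ℕ) :
    ∑ l ∈ primeLists y u w K, listWeight (u * Real.log y) l * (γ l.prod / l.prod)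
      = ∑ m ∈ Finset.range K, ∑ p ∈ Fintype.piFinset (fun _ : Fin (m + 1) => primesLE y),
          (stoppedRegion m u w).indicator (prefixKernel u)
            (fun i => Real.log (p i) / Real.log y) *
          ∏ i, (γ (p i) * Real.log (p i) / p i / Real.log y) := by
  rw [primeLists, Finset.sum_biUnion]
  · refine Finset.sum_congr rfl fun m _ => ?_
    rw [Finset.sum_image (List.ofFn_injective.injOn), primeTuples, Finset.sum_filter]
    refine Finset.sum_congr rfl fun p hp => ?_
    have hprime : ∀ i, (p i).Prime := fun i =>
      prime_of_mem_primesLE (Fintype.mem_piFinset.1 hp i)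
    split_ifs with hreg
    · rw [Set.indicator_of_mem hreg, listWeight_ofFn_eq_prefixKernel (Real.log_pos hy),
        List.prod_ofFn, map_prod_of_multiplicative h1 hmul p hprime
          fun i j hij h => hreg.2.1 i j hij (by simp only [h]),
        Nat.cast_prod, ← Finset.prod_div_distrib, mul_assoc, ← Finset.prod_mul_distrib]
      congr 1
      exact Finset.prod_congr rfl fun i _ => by ring
    · rw [Set.indicator_of_notMem hreg, zero_mul]
  · intro m _ m' _ hmm
    refine Finset.disjoint_left.2 fun l hl hl' => hmm ?_
    obtain ⟨p, -, rfl⟩ := Finset.mem_image.1 hl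
    obtain ⟨p', -, h⟩ := Finset.mem_image.1 hl'
    have := congrArg List.length h
    simp only [List.length_ofFn] at this
    omega

lemma Pplus_le_of_prod_dvd {y u w : ℝ} (hy : 1 < y) {m : ℕ} {p : Fin (m + 1) → ℕ}
    (hp : p ∈ primeTuples y u w m) {n : ℕ} (hn : 0 < n)
    (hlog : Real.log n ≤ u * Real.log y) (hdvd : (List.ofFn p).prod ∣ n) :
    (Pplus n : ℝ) ≤ y := by
  have hy0 : 0 < y := zero_lt_one.trans hy
  have hℓ : 0 < Real.log y := Real.log_pos hy
  obtain ⟨hmem, -, -, -, hlow, -⟩ := mem_primeTuples.1 hp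
  have hprime : ∀ i, (p i).Prime := fun i => prime_of_mem_primesLE (hmem i)
  refine (Nat.le_floor_iff hy0.le).1 (max_le (Nat.le_floor (by exact_mod_cast hy.le)) ?_)
  refine Finset.sup_le fun q hq => ?_
  have hqp := Nat.prime_of_mem_primeFactors hq
  obtain ⟨r, rfl⟩ := hdvd
  have hr : 0 < r := Nat.pos_of_mul_pos_left hn
  have hd : 0 < (List.ofFn p).prod := Nat.pos_of_mul_pos_right hn
  rcases (Nat.Prime.dvd_mul hqp).1 (Nat.dvd_of_mem_primeFactors hq) with h | h
  · rw [List.prod_ofFn] at h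
    obtain ⟨i, -, hi⟩ := (hqp.prime.dvd_finsetProd_iff _).1 h
    rw [id, (Nat.prime_dvd_prime_iff_eq hqp (hprime i)).1 hi]
    exact Nat.lt_succ_iff.1 (Finset.mem_range.1 (Finset.mem_filter.1 (hmem i)).1)
  · rw [Nat.cast_mul, Real.log_mul (by exact_mod_cast hd.ne') (by exact_mod_cast hr.ne'),
      log_prod_ofFn p hprime] at hlog
    rw [← Finset.sum_div, lt_div_iff₀ hℓ] at hlow
    have hqr : Real.log q ≤ Real.log r := Real.log_le_log (by exact_mod_cast hqp.pos)
      (by exact_mod_cast Nat.le_of_dvd hr h)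
    refine Nat.le_floor ((Real.log_le_log_iff (by exact_mod_cast hqp.pos) hy0).1 ?_)
    simp only [id]
    linarith

lemma map_one_eq_one_of_multiplicative {γ : ℕ → ℝ} {κ A : ℝ} (hκ : 0 < κ) (hA : 0 ≤ A)
    (hmul : ∀ m n : ℕ, 0 < m → 0 < n → Nat.Coprime m n → γ (m * n) = γ m * γ n)
    (hγ : ∀ z : ℝ, 2 ≤ z → |(∑ p ∈ primesLE z, γ p * Real.log p / p) - κ * Real.log z| ≤ A) :
    γ 1 = 1 := by
  by_contra hne
  have hsq := hmul 1 1 one_pos one_pos (Nat.coprime_one_left 1)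
  have h0 : γ 1 = 0 := by
    rw [one_mul] at hsq
    by_contra h
    exact hne ((mul_eq_left₀ h).1 hsq.symm)
  have hz : (2 : ℝ) ≤ Real.exp ((A + 1) / κ + 1) := by
    have := Real.add_one_le_exp ((A + 1) / κ + 1)
    have : 0 ≤ (A + 1) / κ := by positivity
    linarith
  have h := hγ _ hz
  rw [Finset.sum_eq_zero, zero_sub, abs_neg, Real.log_exp] at h
  · have h2 := (le_abs_self _).trans h
    rw [mul_add, mul_div_cancel₀ _ hκ.ne'] at h2
    linarith
  · intro p hp
    have := hmul 1 p one_pos (prime_of_mem_primesLE hp).pos (Nat.coprime_one_left p)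
    rw [one_mul, h0, zero_mul] at this
    simp [this]

lemma exists_sub_le_sum_range {a : ℕ → ℝ} {ε : ℝ} (hε : 0 < ε) :
    ∃ K : ℕ, (∑' k, a k) - ε ≤ ∑ k ∈ Finset.range K, a k := by
  by_cases h : Summable a
  · obtain ⟨K, hK⟩ := (h.hasSum.tendsto_sum_nat.eventually_const_lt
      (sub_lt_self _ hε)).exists
    exact ⟨K, hK.le⟩
  · exact ⟨0, by simp [tsum_eq_zero_of_not_summable h, hε.le]⟩

/-- The sieve lower bound in terms of the friable weights, for a fixed number of primes. -/
lemma friable_count_lower_bound {𝒜 : Finset ℕ} {y u w X : ℝ} (hy : 1 < y) (hu : 1 ≤ u)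
    (hw : w ≤ u) (hpos : ∀ n ∈ 𝒜, 0 < n) (hlog : ∀ n ∈ 𝒜, Real.log n ≤ u * Real.log y)
    {γ : ℕ → ℝ} (h1 : γ 1 = 1)
    (hmul : ∀ m n : ℕ, 0 < m → 0 < n → Nat.Coprime m n → γ (m * n) = γ m * γ n) (K : ℕ) :
    X * (∑ m ∈ Finset.range K, ∑ p ∈ Fintype.piFinset (fun _ : Fin (m + 1) => primesLE y),
          (stoppedRegion m u w).indicator (prefixKernel u)
            (fun i => Real.log (p i) / Real.log y) *
          ∏ i, (γ (p i) * Real.log (p i) / p i / Real.log y))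
      - ∑ d ∈ Finset.Icc 1 ⌊y ^ w⌋₊,
          |((𝒜.filter (fun n => d ∣ n)).card : ℝ) - γ d * X / d|
      ≤ ((𝒜.filter (fun n => (Pplus n : ℝ) ≤ y)).card : ℝ) := by
  have hy0 : 0 < y := zero_lt_one.trans hy
  have hℓ : 0 < Real.log y := Real.log_pos hy
  have hprime : ∀ {m : ℕ} {p : Fin (m + 1) → ℕ}, p ∈ primeTuples y u w m →
      ∀ i, (p i).Prime := fun hp i => prime_of_mem_primesLE ((mem_primeTuples.1 hp).1 i)
  have hprodlog : ∀ l ∈ primeLists y u w K, Real.log (l.prod : ℕ) ≤ w * Real.log y := by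
    intro l hl
    obtain ⟨m, -, p, hp, rfl⟩ := mem_primeLists.1 hl
    obtain ⟨-, -, -, -, -, hup⟩ := mem_primeTuples.1 hp
    rw [← Finset.sum_div, div_lt_iff₀ hℓ] at hup
    rw [log_prod_ofFn p (hprime hp)]
    exact hup.le
  have hlprime : ∀ l ∈ primeLists y u w K, ∀ q ∈ l, q.Prime := by
    intro l hl q hq
    obtain ⟨m, -, p, hp, rfl⟩ := mem_primeLists.1 hl
    obtain ⟨i, rfl⟩ := List.mem_ofFn.1 hq
    exact hprime hp i
  rw [← sum_primeLists_eq h1 hmul hy K]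
  refine sieve_lower_bound 𝒜 _ _ X γ _ _ hpos hlog hlprime ?_ ?_ ?_ ?_ ?_
  · intro l hl l' hl'
    obtain ⟨m, -, p, hp, rfl⟩ := mem_primeLists.1 hl
    obtain ⟨m', -, p', hp', rfl⟩ := mem_primeLists.1 hl'
    exact eq_of_prefix_of_mem_stoppedRegion hℓ (mem_primeTuples.1 hp).2
      (mem_primeTuples.1 hp').2
  · intro l hl
    have hl0 : (0 : ℝ) < (l.prod : ℕ) := by
      exact_mod_cast List.prod_pos fun q hq => (hlprime l hl q hq).pos
    refine Nat.le_floor ((Real.log_le_log_iff hl0 (Real.rpow_pos_of_pos hy0 w)).1 ?_)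
    rw [Real.log_rpow hy0]
    exact hprodlog l hl
  · exact fun l hl => (hprodlog l hl).trans (mul_le_mul_of_nonneg_right hw hℓ.le)
  · intro l hl
    obtain ⟨m, -, p, hp, rfl⟩ := mem_primeLists.1 hl
    obtain ⟨-, hreg⟩ := mem_primeTuples.1 hp
    rw [listWeight_ofFn_eq_prefixKernel hℓ]
    exact mul_nonneg (prefixKernel_nonneg hu hreg)
      (Finset.prod_nonneg fun i _ => (hreg.1 i).1.le)
  · intro l hl n hn hdvd
    obtain ⟨m, -, p, hp, rfl⟩ := mem_primeLists.1 hl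
    exact Pplus_le_of_prod_dvd hy hp (hpos n hn) (hlog n hn) hdvd

/-- The effective lower-bound sieve for friable integers (Théorème 1.1). -/
theorem effective_friable_sieve
    (u θ κ A B C δ ε : ℝ)
    (hu : 1 ≤ u) (hθ0 : 0 < θ) (hθ1 : θ < 1) (hθu : (1 - θ) * u < 1)
    (hκ : 0 < κ) (hA : 0 ≤ A) (hB : 0 ≤ B) (hC : 0 ≤ C) (hδ : 0 < δ) (hε : 0 < ε) :
    ∃ x₀ : ℝ, ∀ (𝒜 : Finset ℕ) (h𝒜 : 𝒜.Nonempty),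
      (∀ n ∈ 𝒜, 0 < n) →
      ∀ x y : ℝ, x = (𝒜.max' h𝒜 : ℝ) → y = x ^ (1 / u : ℝ) →
      x₀ ≤ x →
      ∀ X : ℝ, 0 < X →
      ∀ γ : ℕ → ℝ,
        (∀ n : ℕ, 0 < n → 0 ≤ γ n) →
        (∀ m n : ℕ, 0 < m → 0 < n → Nat.Coprime m n → γ (m * n) = γ m * γ n) →
        (∀ z : ℝ, 2 ≤ z →
          |(∑ p ∈ (Finset.range (⌊z⌋₊ + 1)).filter Nat.Prime,
              γ p * Real.log p / p) - κ * Real.log z| ≤ A) →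
        (∀ p : ℕ, p.Prime → ∀ α : ℕ, 1 ≤ α → γ (p ^ α) ≤ B) →
        (∑ d ∈ Finset.Icc 1 ⌊y ^ (u * θ)⌋₊,
            |((𝒜.filter (fun n => d ∣ n)).card : ℝ) - γ d * X / d|
          ≤ C * X / Real.log y ^ δ) →
        (rhotheta θ κ u - ε) * (𝒜.card : ℝ)
          ≤ ((𝒜.filter (fun n => (Pplus n : ℝ) ≤ y)).card : ℝ) := by
  set w : ℝ := u * θ with hwdef
  have hwu : u - (1 - θ) * u = w := by rw [hwdef]; ring
  have hwle : w ≤ u := mul_le_of_le_one_right (by linarith) hθ1.le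
  have hw0 : 0 < w := mul_pos (by linarith) hθ0
  set ρ := rhotheta θ κ u with hρ
  by_cases hρε : ρ - ε ≤ 0
  · refine ⟨0, fun 𝒜 _ _ x y _ _ _ X _ γ _ _ _ _ _ => ?_⟩
    exact (mul_nonpos_of_nonpos_of_nonneg hρε (Nat.cast_nonneg _)).trans (Nat.cast_nonneg _)
  push Not at hρε
  obtain ⟨K, hK⟩ := exists_sub_le_sum_range
    (a := fun k : ℕ => κ ^ (k + 1) * muk (k + 1) u ((1 - θ) * u)) (half_pos (half_pos hε))
  change ρ - ε / 2 / 2 ≤ _ at hK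
  have hε' : 0 < ε / 4 / (K + 1) := by positivity
  have hη := (Finset.eventually_all (Finset.range K)).2 fun m _ => eventually_integral_le_sum
    (lowerSemicontinuous_indicator_prefixKernel m w hu) (indicator_prefixKernel_nonneg w hu)
    (indicator_prefixKernel_le_one w hu)
    (fun t ht => (Set.mem_of_indicator_ne_zero ht).1) hκ hε'
  have hy_lim : Filter.Tendsto (fun x : ℝ => x ^ (1 / u : ℝ)) Filter.atTop Filter.atTop :=
    tendsto_rpow_atTop (by positivity)
  have hlog_lim : Filter.Tendsto (fun x : ℝ => Real.log (x ^ (1 / u : ℝ))) Filter.atTop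
      Filter.atTop := Real.tendsto_log_atTop.comp hy_lim
  have hη_lim := (hlog_lim.const_div_atTop (2 * (A + κ * Real.log 2))).eventually hη
  have he_lim : ∀ᶠ x : ℝ in Filter.atTop,
      C / Real.log (x ^ (1 / u : ℝ)) ^ δ < ε / 2 / (1 + ρ) :=
    (((tendsto_rpow_atTop hδ).comp hlog_lim).const_div_atTop C).eventually_lt_const
      (by have : 0 < 1 + ρ := by linarith
          positivity)
  obtain ⟨x₀, hx₀⟩ := Filter.eventually_atTop.1
    (hη_lim.and (he_lim.and ((hy_lim.eventually_gt_atTop 1).and (Filter.eventually_gt_atTop 0))))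
  refine ⟨x₀, fun 𝒜 h𝒜 hpos x y hx hy hxx X hX γ hγ0 hmul hmert _ hrem => ?_⟩
  obtain ⟨hbox, he, hy1, hx0⟩ := hx₀ x hxx
  rw [← hy] at hbox he hy1
  have hy0 : 0 < y := zero_lt_one.trans hy1
  have hlogx : u * Real.log y = Real.log x := by
    rw [hy, Real.log_rpow hx0]
    field_simp
  have hlog : ∀ n ∈ 𝒜, Real.log n ≤ u * Real.log y := by
    intro n hn
    rw [hlogx, hx]
    exact Real.log_le_log (by exact_mod_cast hpos n hn) (by exact_mod_cast 𝒜.le_max' n hn)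
  have h1 : γ 1 = 1 := map_one_eq_one_of_multiplicative hκ hA hmul hmert
  have hcount := friable_count_lower_bound (X := X) hy1 hu hwle hpos hlog h1 hmul K
  have hmain : ρ - ε / 2 ≤
      ∑ m ∈ Finset.range K, ∑ p ∈ Fintype.piFinset (fun _ : Fin (m + 1) => primesLE y),
          (stoppedRegion m u w).indicator (prefixKernel u)
            (fun i => Real.log (p i) / Real.log y) *
          ∏ i, (γ (p i) * Real.log (p i) / p i / Real.log y) := by
    have hKε : (K : ℝ) * (ε / 4 / (K + 1)) ≤ ε / 4 := by
      rw [mul_div_assoc', div_le_iff₀ (by positivity)]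
      nlinarith
    have hsum : ρ - ε / 2 ≤ ∑ m ∈ Finset.range K,
        (κ ^ (m + 1) * muk (m + 1) u ((1 - θ) * u) - ε / 4 / (K + 1)) := by
      rw [Finset.sum_sub_distrib, Finset.sum_const, Finset.card_range, nsmul_eq_mul]
      linarith
    refine hsum.trans (Finset.sum_le_sum fun m hm => ?_)
    have := hbox m hm (primesLE y) (fun p => γ p * Real.log p / p / Real.log y)
      (fun p => Real.log p / Real.log y)
      (fun p hp => div_nonneg (div_nonneg (mul_nonneg
        (hγ0 p (prime_of_mem_primesLE hp).pos) (Real.log_natCast_nonneg p))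
        (Nat.cast_nonneg p)) (Real.log_pos hy1).le)
      (le_sum_primesLE_interval hκ hA hy1 hmert)
    rwa [← hwu, integral_indicator_prefixKernel, hwu] at this
  set e := C / Real.log y ^ δ with he_def
  have he0 : 0 ≤ e := div_nonneg hC (Real.rpow_nonneg (Real.log_pos hy1).le _)
  have hremX : C * X / Real.log y ^ δ = X * e := by rw [he_def]; ring
  rw [hremX] at hrem
  have hcard : (𝒜.card : ℝ) ≤ X * (1 + e) := by
    have hmem : 1 ∈ Finset.Icc 1 ⌊y ^ w⌋₊ := Finset.mem_Icc.2
      ⟨le_rfl, Nat.le_floor (by exact_mod_cast Real.one_le_rpow hy1.le hw0.le)⟩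
    have hle := (Finset.single_le_sum (f := fun d : ℕ =>
      |((𝒜.filter (fun n => d ∣ n)).card : ℝ) - γ d * X / d|)
      (fun _ _ => abs_nonneg _) hmem).trans hrem
    have hall : 𝒜.filter (fun n => 1 ∣ n) = 𝒜 := Finset.filter_true_of_mem fun n _ => one_dvd n
    simp only [hall, h1, Nat.cast_one, one_mul, div_one] at hle
    linarith [(abs_le.1 hle).2]
  have heρ : e * (1 + ρ) ≤ ε / 2 := by
    have : 0 < 1 + ρ := by linarith
    exact ((lt_div_iff₀ this).1 he).le
  calc (ρ - ε) * (𝒜.card : ℝ) ≤ (ρ - ε) * (X * (1 + e)) :=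
        mul_le_mul_of_nonneg_left hcard hρε.le
    _ = X * ((ρ - ε) * (1 + e)) := by ring
    _ ≤ X * (ρ - ε / 2 - e) := by
        refine mul_le_mul_of_nonneg_left ?_ hX.le
        nlinarith
    _ ≤ _ := by
        have := mul_le_mul_of_nonneg_left hmain hX.le
        linarith
end

section
/- Let F ∈ ℤ[X] be irreducible over ℚ of degree g ≥ 2. For every ε > 0 there exists x₀ such that for all real x ≥ x₀ and all real y with x^{g−1} < y ≤ x^g, setting u := log x / log y (so u ∈ [1/g, 1/(g−1))), one has #{n ∈ ℕ : 1 ≤ n ≤ x, F(n) ≠ 0, P⁺(|F(n)|) ≤ y} ≥ (1 + u − g·u − ε)·x. -/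
attribute [local instance] Classical.propDecidable

open Polynomial NumberField

/-- If `β` is an integral primitive element, a fixed nonzero multiple of every algebraic integer
lies in `ℤ[β]`. -/
lemma exists_nat_mul_eq_aeval {K : Type*} [Field K] [NumberField K] (β : 𝓞 K)
    (hβ : Algebra.adjoin ℚ {(β : K)} = ⊤) :
    ∃ M : ℕ, M ≠ 0 ∧ ∀ w : 𝓞 K, ∃ H : ℤ[X], (M : 𝓞 K) * w = aeval β H := by
  have step : ∀ w : 𝓞 K, ∃ M : ℕ, M ≠ 0 ∧ (M : 𝓞 K) * w ∈ Algebra.adjoin ℤ {β} := by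
    intro w
    have hw : (w : K) ∈ Algebra.adjoin ℚ {(β : K)} := hβ ▸ Algebra.mem_top
    rw [Algebra.adjoin_singleton_eq_range_aeval] at hw
    obtain ⟨h, hh⟩ := hw
    obtain ⟨b, hb0, hb⟩ := IsLocalization.integerNormalization_spec (nonZeroDivisors ℤ) h
    set G := IsLocalization.integerNormalization (nonZeroDivisors ℤ) h
    have hbw : (b : 𝓞 K) * w = aeval β G := by
      apply RingOfIntegers.coe_injective
      have h1 : aeval (β : K) (G.map (algebraMap ℤ ℚ)) = b • (w : K) := by
        rw [hb, map_zsmul]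
        exact congrArg _ hh
      rw [aeval_map_algebraMap] at h1
      have h2 : algebraMap (𝓞 K) K (aeval β G) = aeval (β : K) G :=
        (aeval_algebraMap_apply K β G).symm
      rw [h2, h1]
      simp
    refine ⟨b.natAbs, by simpa using nonZeroDivisors.ne_zero hb0, ?_⟩
    have hmem : (b : 𝓞 K) * w ∈ Algebra.adjoin ℤ {β} := by
      rw [hbw]
      exact aeval_mem_adjoin_singleton _ _
    rcases Int.natAbs_eq b with h | h
    · rw [h] at hmem
      simpa using hmem
    · rw [h] at hmem
      simpa using hmem
  choose M hM hMw using step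
  obtain ⟨s, hs⟩ := (Module.Finite.fg_top : (⊤ : Submodule ℤ (𝓞 K)).FG)
  refine ⟨∏ w ∈ s, M w, Finset.prod_ne_zero_iff.mpr fun w _ => hM w, fun w => ?_⟩
  have key : ((∏ w ∈ s, M w : ℕ) : 𝓞 K) * w ∈ Algebra.adjoin ℤ {β} := by
    have hw : w ∈ Submodule.span ℤ (s : Set (𝓞 K)) := hs ▸ Submodule.mem_top
    induction hw using Submodule.span_induction with
    | mem x hx =>
      rw [← Finset.prod_erase_mul _ _ (Finset.mem_coe.mp hx), Nat.cast_mul, mul_assoc]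
      exact mul_mem (natCast_mem _ _) (hMw x)
    | zero => simp
    | add x y _ _ hx hy => rw [mul_add]; exact add_mem hx hy
    | smul a x _ hx => rw [mul_smul_comm]; exact Subalgebra.smul_mem _ hx a
  rw [Algebra.adjoin_singleton_eq_range_aeval] at key
  obtain ⟨H, hH⟩ := key
  exact ⟨H, hH.symm⟩

/-- A prime ideal of prime norm `p` is the kernel of a ring homomorphism to `ZMod p`. -/
lemma exists_ringHom_zmod_ker_eq {R : Type*} [CommRing R] [IsDedekindDomain R] [Module.Free ℤ R]
    {p : ℕ} (hp : p.Prime) (P : Ideal R) (hP : Ideal.absNorm P = p) :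
    ∃ φ : R →+* ZMod p, RingHom.ker φ = P := by
  have hcard : Nat.card (R ⧸ P) = p := hP
  have : Finite (R ⧸ P) := Nat.finite_of_card_ne_zero (hcard ▸ hp.ne_zero)
  let _ := Fintype.ofFinite (R ⧸ P)
  let e := ZMod.ringEquivOfPrime (R ⧸ P) hp (by rw [← Nat.card_eq_fintype_card, hcard])
  refine ⟨(e.symm : (R ⧸ P) →+* ZMod p).comp (Ideal.Quotient.mk P), ?_⟩
  ext x
  simp [RingHom.mem_ker, Ideal.Quotient.eq_zero_iff_mem]

/-- Let `K = ℚ(α)` with `F(α) = 0`. For all but finitely many primes `p`, there are at most as many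
prime ideals of norm `p` as roots of `F` modulo `p`. -/
lemma exists_forall_ncard_absNorm_eq_le_card_roots {K : Type*} [Field K] [NumberField K]
    {F : ℤ[X]} (hF : F ≠ 0) {α : K} (hα : aeval α F = 0) (htop : Algebra.adjoin ℚ {α} = ⊤) :
    ∃ p₀ : ℕ, ∀ p : ℕ, ∀ [Fact p.Prime], p₀ < p →
      {P : Ideal (𝓞 K) | Ideal.absNorm P = p}.ncard ≤
        (Finset.univ.filter fun z : ZMod p => aeval z F = 0).card := by
  have ha : F.leadingCoeff ≠ 0 := leadingCoeff_ne_zero.mpr hF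
  set a := F.leadingCoeff with ha_def
  let β : 𝓞 K := ⟨a • α, isIntegral_leadingCoeff_smul F α hα⟩
  have hβα : (β : K) = (a : K) * α := by
    simp [β, RingOfIntegers.map_mk]
  have hβ : Algebra.adjoin ℚ {(β : K)} = ⊤ := by
    rw [eq_top_iff, ← htop]
    refine Algebra.adjoin_le (Set.singleton_subset_iff.mpr ?_)
    have : α = (a : ℚ)⁻¹ • (β : K) := by
      rw [hβα, Algebra.smul_def, ← mul_assoc]
      have : algebraMap ℚ K (a : ℚ)⁻¹ * (a : K) = 1 := by
        have h2 : (a : K) = algebraMap ℚ K (a : ℚ) := by simp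
        rw [h2, ← map_mul, inv_mul_cancel₀ (by exact_mod_cast ha), map_one]
      rw [this, one_mul]
    rw [SetLike.mem_coe, this]
    exact Subalgebra.smul_mem _ (Algebra.self_mem_adjoin_singleton _ _) _
  obtain ⟨M, hM, hMw⟩ := exists_nat_mul_eq_aeval β hβ
  have hscale : aeval β (F.scaleRoots a) = 0 := by
    apply RingOfIntegers.coe_injective
    have h2 : algebraMap (𝓞 K) K (aeval β (F.scaleRoots a)) = aeval (β : K) (F.scaleRoots a) :=
      (aeval_algebraMap_apply K β _).symm
    rw [h2, map_zero, hβα, aeval_def]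
    have := F.scaleRoots_eval₂_mul (algebraMap ℤ K) α a
    rw [← aeval_def α F, hα, mul_zero] at this
    simpa using this
  refine ⟨max M a.natAbs, fun p hp hlt => ?_⟩
  have hMp : (M : ZMod p) ≠ 0 := by
    rw [Ne, ZMod.natCast_eq_zero_iff]
    exact fun h => absurd (Nat.le_of_dvd (Nat.pos_of_ne_zero hM) h) (by omega)
  have hap : (a : ZMod p) ≠ 0 := by
    rw [Ne, ZMod.intCast_zmod_eq_zero_iff_dvd, ← Int.natAbs_dvd_natAbs]
    exact fun h => absurd (Nat.le_of_dvd (by omega) h) (by simp; omega)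
  have hker := fun P : {P : Ideal (𝓞 K) | Ideal.absNorm P = p} =>
    exists_ringHom_zmod_ker_eq hp.out P.1 P.2
  choose φ hφ using hker
  have heval : ∀ P (H : ℤ[X]), φ P (aeval β H) = aeval (φ P β) H := fun P H => by
    simp only [aeval_def, hom_eval₂]
    congr 1
    exact Subsingleton.elim _ _
  have hdet : ∀ P Q, φ P β = φ Q β → φ P = φ Q := by
    intro P Q h
    ext w
    obtain ⟨H, hH⟩ := hMw w
    have hP : ∀ P, (M : ZMod p) * φ P w = aeval (φ P β) H := by
      intro P
      rw [← heval, ← hH, map_mul, map_natCast]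
    exact mul_left_cancel₀ hMp (by rw [hP, hP, h])
  have hroot : ∀ P, aeval (φ P β / a) F = 0 := by
    intro P
    have h1 := F.scaleRoots_eval₂_mul (algebraMap ℤ (ZMod p)) (φ P β / a) a
    have h2 : algebraMap ℤ (ZMod p) a * (φ P β / a) = φ P β := by
      simp [mul_div_cancel₀ _ hap]
    rw [h2, ← aeval_def, ← aeval_def, ← heval, hscale, map_zero] at h1
    exact (mul_eq_zero.mp h1.symm).resolve_left (pow_ne_zero _ (by simpa using hap))
  let r : {P : Ideal (𝓞 K) | Ideal.absNorm P = p} →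
      (Finset.univ.filter fun z : ZMod p => aeval z F = 0) :=
    fun P => ⟨φ P β / a, by simpa using hroot P⟩
  have hr : Function.Injective r := fun P Q h => by
    have h' : φ P β / a = φ Q β / a := congrArg Subtype.val h
    rw [div_left_inj' hap] at h'
    exact Subtype.ext (by rw [← hφ P, ← hφ Q, hdet P Q h'])
  rw [← Nat.card_coe_set_eq]
  exact (Nat.card_le_card_of_injective r hr).trans_eq
    (by rw [Nat.card_eq_fintype_card, Fintype.card_coe])

section NumberField

variable (K : Type*) [Field K] [NumberField K]

/-- The nonzero ideals of norm at most `n`. -/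
noncomputable def idealsNormLE (n : ℕ) : Finset (Ideal (𝓞 K)) :=
  (Ideal.finite_setOfPred_absNorm_le (S := 𝓞 K) n).toFinset.filter (· ≠ ⊥)

variable {K}

@[simp]
lemma mem_idealsNormLE {n : ℕ} {I : Ideal (𝓞 K)} :
    I ∈ idealsNormLE K n ↔ Ideal.absNorm I ≤ n ∧ I ≠ ⊥ := by
  simp [idealsNormLE]

variable (K) in
lemma tendsto_card_idealsNormLE_div :
    ∃ κ : ℝ, 0 < κ ∧ Filter.Tendsto (fun n : ℕ => ((idealsNormLE K n).card : ℝ) / n)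
      Filter.atTop (nhds κ) := by
  refine ⟨_, dedekindZeta_residue_pos K, ?_⟩
  rw [dedekindZeta_residue_def]
  refine ((Ideal.tendsto_norm_le_div_atTop₀ K).comp tendsto_natCast_atTop_atTop).congr fun n => ?_
  simp only [Function.comp_apply, Nat.cast_le]
  congr 2
  rw [Nat.card_congr (Equiv.subtypeSubtypeEquivSubtypeInter (· ∈ nonZeroDivisors (Ideal (𝓞 K)))
    fun I => Ideal.absNorm I ≤ n)]
  exact Nat.subtype_card _ fun I => by simp [and_comm]

lemma absNorm_minFac_mem {P : Ideal (𝓞 K)} (hP : P.IsPrime) (h0 : P ≠ ⊥) :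
    (Ideal.absNorm P).minFac.Prime ∧ ((Ideal.absNorm P).minFac : 𝓞 K) ∈ P ∧
      ∃ f, f ≠ 0 ∧ Ideal.absNorm P = (Ideal.absNorm P).minFac ^ f := by
  have : NeZero P := ⟨h0⟩
  have hp := Nat.absNorm_under_prime P
  have hmem := Int.absNorm_under_mem P
  set p := Ideal.absNorm (P.under ℤ) with hpdef
  have hdvd : P ∣ Ideal.span {(p : 𝓞 K)} := by
    rw [Ideal.dvd_span_singleton]
    exact_mod_cast hmem
  have h1 : Ideal.absNorm P ∣ p ^ Module.finrank ℤ (𝓞 K) := by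
    have := map_dvd Ideal.absNorm hdvd
    rwa [Ideal.absNorm_span_natCast] at this
  obtain ⟨f, _, hf⟩ := (Nat.dvd_prime_pow hp).mp h1
  have hne : Ideal.absNorm P ≠ 1 := by
    rw [Ne, Ideal.absNorm_eq_one_iff]
    exact hP.ne_top
  have hf0 : f ≠ 0 := by
    rintro rfl
    exact hne (by simpa using hf)
  have hmin : (Ideal.absNorm P).minFac = p := by
    rw [hf, hp.pow_minFac hf0]
  rw [hmin]
  exact ⟨hp, by exact_mod_cast hmem, f, hf0, hf⟩

lemma card_le_finrank_of_forall_minFac_eq {T : Finset (Ideal (𝓞 K))} {p : ℕ}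
    (hT : ∀ P ∈ T, P.IsPrime ∧ P ≠ ⊥ ∧ (Ideal.absNorm P).minFac = p) :
    T.card ≤ Module.finrank ℤ (𝓞 K) := by
  rcases T.eq_empty_or_nonempty with rfl | ⟨P₀, hP₀⟩
  · simp
  have hp : p.Prime := (hT P₀ hP₀).2.2 ▸ (absNorm_minFac_mem (hT P₀ hP₀).1 (hT P₀ hP₀).2.1).1
  have hdvd : ∏ P ∈ T, P ∣ Ideal.span {(p : 𝓞 K)} := by
    refine Finset.prod_primes_dvd _ (fun P hP => Ideal.prime_of_isPrime (hT P hP).2.1 (hT P hP).1)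
      fun P hP => ?_
    rw [Ideal.dvd_span_singleton]
    obtain ⟨h1, h2, h3⟩ := hT P hP
    exact h3 ▸ (absNorm_minFac_mem h1 h2).2.1
  have h1 : (∏ P ∈ T, Ideal.absNorm P) ∣ p ^ Module.finrank ℤ (𝓞 K) := by
    have := map_dvd Ideal.absNorm hdvd
    rwa [Ideal.absNorm_span_natCast, map_prod] at this
  have h2 : p ^ T.card ∣ ∏ P ∈ T, Ideal.absNorm P := by
    rw [← Finset.prod_const]
    exact Finset.prod_dvd_prod_of_dvd _ _ fun P hP => (hT P hP).2.2 ▸ Nat.minFac_dvd _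
  exact (Nat.pow_dvd_pow_iff_le_right hp.one_lt).mp (h2.trans h1)

variable (K) in
lemma exists_sum_minFac_rpow_le :
    ∃ Z : ℝ, 0 ≤ Z ∧ ∀ T : Finset (Ideal (𝓞 K)), (∀ P ∈ T, P.IsPrime ∧ P ≠ ⊥) →
      ∑ P ∈ T, ((Ideal.absNorm P).minFac : ℝ) ^ (-(3 / 2) : ℝ) ≤ Z := by
  have hsum : Summable fun n : ℕ => (n : ℝ) ^ (-(3 / 2) : ℝ) :=
    Real.summable_nat_rpow.mpr (by norm_num)
  refine ⟨Module.finrank ℤ (𝓞 K) * ∑' n : ℕ, (n : ℝ) ^ (-(3 / 2) : ℝ),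
    mul_nonneg (by positivity) (tsum_nonneg fun n => by positivity), fun T hT => ?_⟩
  calc ∑ P ∈ T, ((Ideal.absNorm P).minFac : ℝ) ^ (-(3 / 2) : ℝ)
      = ∑ p ∈ T.image fun P => (Ideal.absNorm P).minFac,
          ((T.filter fun P => (Ideal.absNorm P).minFac = p).card : ℝ) *
            (p : ℝ) ^ (-(3 / 2) : ℝ) := by
        rw [Finset.sum_comp (fun p : ℕ => (p : ℝ) ^ (-(3 / 2) : ℝ))
          fun P : Ideal (𝓞 K) => (Ideal.absNorm P).minFac]
        simp
    _ ≤ ∑ p ∈ T.image fun P => (Ideal.absNorm P).minFac,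
          (Module.finrank ℤ (𝓞 K) : ℝ) * (p : ℝ) ^ (-(3 / 2) : ℝ) := by
        gcongr with p hp
        refine card_le_finrank_of_forall_minFac_eq (p := p) fun P hP => ?_
        rw [Finset.mem_filter] at hP
        exact ⟨(hT P hP.1).1, (hT P hP.1).2, hP.2⟩
    _ ≤ _ := by
        rw [← Finset.mul_sum]
        gcongr
        exact hsum.sum_le_tsum _ fun n _ => by positivity

/-- The logarithmic weight of an ideal, decomposed along its prime power divisors. -/
lemma log_absNorm_eq_sum {n : ℕ} {I : Ideal (𝓞 K)} (hI : I ∈ idealsNormLE K n) :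
    Real.log (Ideal.absNorm I) =
      ∑ P ∈ (idealsNormLE K n).filter Ideal.IsPrime, ∑ k ∈ Finset.Icc 1 n,
        if P ^ k ∣ I then Real.log (Ideal.absNorm P) else 0 := by
  rw [mem_idealsNormLE] at hI
  obtain ⟨hIn, hI0⟩ := hI
  have hNI : 0 < Ideal.absNorm I := Nat.pos_of_ne_zero (by simpa [Ideal.absNorm_eq_zero_iff])
  set s := UniqueFactorizationMonoid.normalizedFactors I with hs
  have hprod : s.prod = I := by
    rw [hs]
    exact associated_iff_eq.mp (UniqueFactorizationMonoid.prod_normalizedFactors hI0)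
  have hsub : s.toFinset ⊆ (idealsNormLE K n).filter Ideal.IsPrime := by
    intro P hP
    rw [Multiset.mem_toFinset] at hP
    have hPp := UniqueFactorizationMonoid.prime_of_normalized_factor P hP
    rw [Finset.mem_filter, mem_idealsNormLE]
    refine ⟨⟨(Nat.le_of_dvd hNI (map_dvd _ ?_)).trans hIn, hPp.ne_zero⟩, Ideal.isPrime_of_prime hPp⟩
    exact UniqueFactorizationMonoid.dvd_of_mem_normalizedFactors hP
  have hcount : ∀ P ∈ (idealsNormLE K n).filter Ideal.IsPrime,
      ((Finset.Icc 1 n).filter fun k => P ^ k ∣ I).card = s.count P := by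
    intro P hP
    rw [Finset.mem_filter, mem_idealsNormLE] at hP
    have hPp : Prime P := Ideal.prime_of_isPrime hP.1.2 hP.2
    have hiff : ∀ k, P ^ k ∣ I ↔ k ≤ s.count P := fun k => by
      rw [pow_dvd_iff_le_emultiplicity,
        UniqueFactorizationMonoid.emultiplicity_eq_count_normalizedFactors hPp.irreducible hI0,
        normalize_eq, Nat.cast_le]
    have hle : s.count P ≤ n := by
      have h1 : Ideal.absNorm P ^ s.count P ≤ n := by
        rw [← map_pow]
        exact (Nat.le_of_dvd hNI (map_dvd _ ((hiff _).mpr le_rfl))).trans hIn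
      have h2 : 2 ≤ Ideal.absNorm P := by
        have h3 : Ideal.absNorm P ≠ 0 := by simpa [Ideal.absNorm_eq_zero_iff] using hP.1.2
        have h4 : Ideal.absNorm P ≠ 1 := by
          rw [Ne, Ideal.absNorm_eq_one_iff]
          exact hP.2.ne_top
        omega
      exact (Nat.lt_pow_self h2).le.trans h1
    have : (Finset.Icc 1 n).filter (fun k => P ^ k ∣ I) = Finset.Icc 1 (s.count P) := by
      ext k
      simp only [Finset.mem_filter, Finset.mem_Icc, hiff]
      omega
    rw [this, Nat.card_Icc, Nat.add_sub_cancel]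
  calc Real.log (Ideal.absNorm I)
      = ∑ P ∈ s.toFinset, (s.count P : ℝ) * Real.log (Ideal.absNorm P) := by
        conv_lhs => rw [← hprod, Finset.prod_multiset_count, map_prod, Nat.cast_prod]
        rw [Real.log_prod]
        · simp
        · intro P hP
          have := (Finset.mem_filter.mp (hsub hP)).1
          rw [mem_idealsNormLE] at this
          simpa [Ideal.absNorm_eq_zero_iff] using fun h => absurd h this.2
    _ = ∑ P ∈ (idealsNormLE K n).filter Ideal.IsPrime,
          (s.count P : ℝ) * Real.log (Ideal.absNorm P) := by
        refine Finset.sum_subset hsub fun P _ hP => ?_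
        rw [Multiset.mem_toFinset] at hP
        simp [Multiset.count_eq_zero_of_notMem hP]
    _ = _ := by
        refine Finset.sum_congr rfl fun P hP => ?_
        rw [← Finset.sum_filter, Finset.sum_const, hcount P hP, nsmul_eq_mul]

lemma card_filter_dvd_idealsNormLE_le {n : ℕ} {J : Ideal (𝓞 K)} (hJ : J ≠ ⊥) :
    ((idealsNormLE K n).filter fun I => J ∣ I).card ≤
      (idealsNormLE K (n / Ideal.absNorm J)).card := by
  refine (Finset.card_le_card (t := (idealsNormLE K (n / Ideal.absNorm J)).image (J * ·)) ?_).trans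
    Finset.card_image_le
  intro I hI
  rw [Finset.mem_filter, mem_idealsNormLE] at hI
  obtain ⟨⟨hIn, hI0⟩, L, rfl⟩ := hI
  have hNJ : 0 < Ideal.absNorm J := Nat.pos_of_ne_zero (by simpa [Ideal.absNorm_eq_zero_iff])
  refine Finset.mem_image_of_mem _ (mem_idealsNormLE.mpr ⟨?_, ?_⟩)
  · rw [Nat.le_div_iff_mul_le hNJ, mul_comm, ← map_mul]
    exact hIn
  · rintro rfl
    simp at hI0

/-- Legendre-type inequality for the product of the norms of the ideals of norm at most `n`. -/
lemma sum_log_absNorm_le (n : ℕ) :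
    ∑ I ∈ idealsNormLE K n, Real.log (Ideal.absNorm I) ≤
      ∑ P ∈ (idealsNormLE K n).filter Ideal.IsPrime, ∑ k ∈ Finset.Icc 1 n,
        Real.log (Ideal.absNorm P) * (idealsNormLE K (n / Ideal.absNorm P ^ k)).card := by
  rw [Finset.sum_congr rfl fun I hI => log_absNorm_eq_sum hI, Finset.sum_comm]
  refine Finset.sum_le_sum fun P hP => ?_
  rw [Finset.sum_comm]
  refine Finset.sum_le_sum fun k _ => ?_
  rw [← Finset.sum_filter, Finset.sum_const, nsmul_eq_mul, mul_comm]
  rw [Finset.mem_filter, mem_idealsNormLE] at hP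
  have := card_filter_dvd_idealsNormLE_le (n := n) (pow_ne_zero k hP.1.2)
  rw [map_pow] at this
  gcongr

variable (K) in
/-- The number of ideals of norm exactly `p`. -/
noncomputable def idealsNormEqCard (p : ℕ) : ℕ := {P : Ideal (𝓞 K) | Ideal.absNorm P = p}.ncard

lemma idealsNormEqCard_le_finrank {p : ℕ} (hp : p.Prime) :
    idealsNormEqCard K p ≤ Module.finrank ℤ (𝓞 K) := by
  have hfin := Ideal.finite_setOfPred_absNorm_eq (S := 𝓞 K) p
  rw [idealsNormEqCard, Set.ncard_eq_toFinset_card _ hfin]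
  refine card_le_finrank_of_forall_minFac_eq (p := p) fun P hP => ?_
  have hP' : Ideal.absNorm P = p := by simpa using hP
  refine ⟨Ideal.isPrime_of_irreducible_absNorm (hP' ▸ hp), ?_, ?_⟩
  · rintro rfl
    exact hp.ne_zero (by simpa using hP'.symm)
  · rw [hP', hp.minFac_eq]

lemma sum_log_prime_le (n : ℕ) :
    ∑ p ∈ (Finset.Ioc 0 n).filter Nat.Prime, Real.log p ≤ Real.log 4 * n := by
  have := Chebyshev.theta_le_log4_mul_x (x := n) (by positivity)
  rw [Chebyshev.theta, Nat.floor_natCast] at this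
  convert this

variable (K) in
lemma exists_card_idealsNormLE_le_mul :
    ∃ C : ℝ, 0 ≤ C ∧ ∀ n : ℕ, ((idealsNormLE K n).card : ℝ) ≤ C * n := by
  obtain ⟨κ, _, hκ⟩ := tendsto_card_idealsNormLE_div K
  obtain ⟨C, hC⟩ := hκ.bddAbove_range
  refine ⟨max C 0, le_max_right _ _, fun n => ?_⟩
  rcases n.eq_zero_or_pos with rfl | hn
  · have : idealsNormLE K 0 = ∅ := by
      ext I
      simp [Ideal.absNorm_eq_zero_iff]
    simp [this]
  · have := hC ⟨n, rfl⟩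
    rw [← div_le_iff₀ (by positivity)]
    exact this.trans (le_max_left _ _)

lemma exists_le_mul_add_of_tendsto_div {f : ℕ → ℝ} {κ c : ℝ} (h : κ < c)
    (hf : Filter.Tendsto (fun n : ℕ => f n / n) Filter.atTop (nhds κ)) :
    ∃ C : ℝ, 0 ≤ C ∧ ∀ n : ℕ, f n ≤ c * n + C := by
  obtain ⟨m, hm⟩ := Filter.eventually_atTop.mp (hf.eventually_le_const h)
  refine ⟨∑ i ∈ Finset.range (m + 1), |f i - c * i|, by positivity, fun n => ?_⟩
  rcases le_or_gt n m with hn | hn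
  · have := Finset.single_le_sum (f := fun i : ℕ => |f i - c * i|) (fun i _ => abs_nonneg _)
      (Finset.mem_range.mpr (Nat.lt_succ_of_le hn))
    have h2 := le_abs_self (f n - c * n)
    linarith
  · have h1 := hm n hn.le
    rw [div_le_iff₀ (by exact_mod_cast (by omega : 0 < n))] at h1
    have : 0 ≤ ∑ i ∈ Finset.range (m + 1), |f i - c * i| := by positivity
    linarith

/-- Contribution of the higher powers of a prime ideal of norm `q`. -/
lemma sum_Icc_two_log_mul_le {N : ℕ → ℝ} {C : ℝ} (hC : 0 ≤ C) (hN : ∀ m : ℕ, N m ≤ C * m)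
    {q : ℕ} (hq : 2 ≤ q) (n : ℕ) :
    ∑ k ∈ Finset.Icc 2 n, Real.log q * N (n / q ^ k) ≤
      4 * C * n * (q : ℝ) ^ (-(3 / 2) : ℝ) := by
  have hq' : (2 : ℝ) ≤ q := by exact_mod_cast hq
  have hq0 : (0 : ℝ) < q := by linarith
  have hgeom : ∑ k ∈ Finset.Icc 2 n, ((q : ℝ)⁻¹) ^ k ≤ 2 * ((q : ℝ)⁻¹) ^ 2 := by
    have h1 : (q : ℝ)⁻¹ < 1 := inv_lt_one_of_one_lt₀ (by linarith)
    have h2 := geom_sum_Ico_le_of_lt_one (m := 2) (n := n + 1) (inv_nonneg.mpr hq0.le) h1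
    have h3 : Finset.Icc 2 n = Finset.Ico 2 (n + 1) := by
      ext; simp
    rw [h3]
    refine h2.trans ?_
    rw [div_le_iff₀ (by linarith)]
    have h4 : (q : ℝ)⁻¹ ≤ 2⁻¹ := by gcongr
    have h5 : 0 ≤ ((q : ℝ)⁻¹) ^ 2 := by positivity
    nlinarith
  have hlog : Real.log q ≤ 2 * (q : ℝ) ^ (1 / 2 : ℝ) := by
    have := Real.log_le_rpow_div hq0.le (show (0 : ℝ) < 1 / 2 by norm_num)
    linarith
  have hlog0 : 0 ≤ Real.log q := Real.log_nonneg (by linarith)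
  calc ∑ k ∈ Finset.Icc 2 n, Real.log q * N (n / q ^ k)
      ≤ ∑ k ∈ Finset.Icc 2 n, Real.log q * (C * (n * ((q : ℝ)⁻¹) ^ k)) := by
        refine Finset.sum_le_sum fun k _ => mul_le_mul_of_nonneg_left ((hN _).trans ?_) hlog0
        refine mul_le_mul_of_nonneg_left (Nat.cast_div_le.trans_eq ?_) hC
        simp [div_eq_mul_inv]
    _ = Real.log q * (C * n) * ∑ k ∈ Finset.Icc 2 n, ((q : ℝ)⁻¹) ^ k := by
        rw [Finset.mul_sum]
        exact Finset.sum_congr rfl fun k _ => by ring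
    _ ≤ (2 * (q : ℝ) ^ (1 / 2 : ℝ)) * (C * n) * (2 * ((q : ℝ)⁻¹) ^ 2) := by gcongr
    _ = 4 * C * n * ((q : ℝ) ^ (1 / 2 : ℝ) * (q : ℝ) ^ (-2 : ℝ)) := by
        have : ((q : ℝ)⁻¹) ^ 2 = (q : ℝ) ^ (-2 : ℝ) := by
          rw [Real.rpow_neg hq0.le, inv_pow]
          norm_num
        rw [this]
        ring
    _ = _ := by
        rw [← Real.rpow_add hq0]
        norm_num

/-- Contribution of all powers of a prime ideal `P`, up to the main term. -/
lemma sum_Icc_one_log_absNorm_mul_le {N : ℕ → ℝ} {C : ℝ} (hC : 0 ≤ C)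
    (hN : ∀ m : ℕ, N m ≤ C * m) {P : Ideal (𝓞 K)} (hP : P.IsPrime) (h0 : P ≠ ⊥) {n : ℕ}
    (hn : 1 ≤ n) :
    ∑ k ∈ Finset.Icc 1 n, Real.log (Ideal.absNorm P) * N (n / Ideal.absNorm P ^ k) ≤
      8 * C * n * ((Ideal.absNorm P).minFac : ℝ) ^ (-(3 / 2) : ℝ) +
        if (Ideal.absNorm P).Prime then Real.log (Ideal.absNorm P) * N (n / Ideal.absNorm P)
          else 0 := by
  obtain ⟨hp, -, f, hf0, hf⟩ := absNorm_minFac_mem hP h0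
  set q := Ideal.absNorm P
  set p := q.minFac
  have hpq : p ≤ q := Nat.minFac_le (hf ▸ pow_pos hp.pos f)
  have hq2 : 2 ≤ q := hp.two_le.trans hpq
  have hp0 : (0 : ℝ) < p := by exact_mod_cast hp.pos
  have hq0 : (0 : ℝ) < q := by exact_mod_cast (by omega : 0 < q)
  have hlog0 : 0 ≤ Real.log q := Real.log_natCast_nonneg q
  have hIcc : Finset.Icc 1 n = insert 1 (Finset.Icc 2 n) := by
    ext; simp; omega
  rw [hIcc, Finset.sum_insert (by simp), pow_one]
  have h2 := sum_Icc_two_log_mul_le hC hN hq2 n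
  have h3 : (q : ℝ) ^ (-(3 / 2) : ℝ) ≤ (p : ℝ) ^ (-(3 / 2) : ℝ) :=
    Real.rpow_le_rpow_of_nonpos hp0 (by exact_mod_cast hpq) (by norm_num)
  have h4 : 4 * C * n * (q : ℝ) ^ (-(3 / 2) : ℝ) ≤ 4 * C * n * (p : ℝ) ^ (-(3 / 2) : ℝ) := by
    gcongr
  have h5 : 0 ≤ 4 * C * n * (p : ℝ) ^ (-(3 / 2) : ℝ) := by positivity
  split_ifs with hprime
  · linarith
  · suffices Real.log q * N (n / q) ≤ 4 * C * n * (p : ℝ) ^ (-(3 / 2) : ℝ) by linarith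
    have hf2 : 2 ≤ f := by
      by_contra h
      have : f = 1 := by omega
      rw [this, pow_one] at hf
      exact hprime (hf ▸ hp)
    have hpq2 : (p : ℝ) ^ (2 : ℕ) ≤ q := by
      rw [hf]
      exact_mod_cast Nat.pow_le_pow_right hp.pos hf2
    have hlog : Real.log q ≤ 4 * (q : ℝ) ^ (1 / 4 : ℝ) := by
      have := Real.log_le_rpow_div hq0.le (show (0 : ℝ) < 1 / 4 by norm_num)
      linarith
    calc Real.log q * N (n / q) ≤ Real.log q * (C * (n / q)) := by
          refine mul_le_mul_of_nonneg_left ((hN _).trans ?_) hlog0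
          exact mul_le_mul_of_nonneg_left Nat.cast_div_le hC
      _ ≤ (4 * (q : ℝ) ^ (1 / 4 : ℝ)) * (C * (n / q)) := by gcongr
      _ = 4 * C * n * ((q : ℝ) ^ (1 / 4 : ℝ) * (q : ℝ) ^ (-1 : ℝ)) := by
          rw [Real.rpow_neg_one]
          ring
      _ = 4 * C * n * (q : ℝ) ^ (-(3 / 4) : ℝ) := by
          rw [← Real.rpow_add hq0]
          norm_num
      _ ≤ 4 * C * n * ((p : ℝ) ^ (2 : ℕ)) ^ (-(3 / 4) : ℝ) := by
          gcongr 4 * C * n * ?_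
          exact Real.rpow_le_rpow_of_nonpos (by positivity) hpq2 (by norm_num)
      _ = _ := by
          rw [← Real.rpow_natCast_mul hp0.le]
          norm_num

/-- Upper bound for the logarithmic sum over ideals in terms of the primes of degree one. -/
lemma exists_sum_log_absNorm_le {κ c : ℝ} (hκc : κ < c) (hc : 0 ≤ c)
    (hκ : Filter.Tendsto (fun n : ℕ => ((idealsNormLE K n).card : ℝ) / n)
      Filter.atTop (nhds κ)) :
    ∃ A : ℝ, ∀ n : ℕ, 1 ≤ n → ∑ I ∈ idealsNormLE K n, Real.log (Ideal.absNorm I) ≤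
      c * n * (∑ p ∈ (Finset.Ioc 0 n).filter Nat.Prime,
        idealsNormEqCard K p * (Real.log p / p)) + A * n := by
  obtain ⟨C, hC0, hC⟩ := exists_card_idealsNormLE_le_mul K
  obtain ⟨C', hC'0, hC'⟩ := exists_le_mul_add_of_tendsto_div hκc hκ
  obtain ⟨Z, hZ0, hZ⟩ := exists_sum_minFac_rpow_le K
  set d := Module.finrank ℤ (𝓞 K)
  refine ⟨8 * C * Z + d * C' * Real.log 4, fun n hn => ?_⟩
  set T := (idealsNormLE K n).filter Ideal.IsPrime with hT
  have hTmem : ∀ P ∈ T, P.IsPrime ∧ P ≠ ⊥ := fun P hP => by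
    rw [hT, Finset.mem_filter, mem_idealsNormLE] at hP
    exact ⟨hP.2, hP.1.2⟩
  have hmain : ∑ P ∈ T, (if (Ideal.absNorm P).Prime then Real.log (Ideal.absNorm P) *
      ((idealsNormLE K (n / Ideal.absNorm P)).card : ℝ) else 0) ≤
      ∑ p ∈ (Finset.Ioc 0 n).filter Nat.Prime, idealsNormEqCard K p *
        (Real.log p * (idealsNormLE K (n / p)).card) := by
    rw [← Finset.sum_filter]
    have hmaps : ∀ P ∈ T.filter fun P => (Ideal.absNorm P).Prime,
        Ideal.absNorm P ∈ (Finset.Ioc 0 n).filter Nat.Prime := fun P hP => by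
      simp only [hT, Finset.mem_filter, mem_idealsNormLE] at hP
      simp only [Finset.mem_filter, Finset.mem_Ioc]
      exact ⟨⟨hP.2.pos, hP.1.1.1⟩, hP.2⟩
    rw [← Finset.sum_fiberwise_of_maps_to hmaps]
    refine Finset.sum_le_sum fun p hp => ?_
    rw [Finset.sum_congr rfl (g := fun _ => Real.log p * ((idealsNormLE K (n / p)).card : ℝ))
      fun P hP => by rw [(Finset.mem_filter.mp hP).2], Finset.sum_const, nsmul_eq_mul]
    refine mul_le_mul_of_nonneg_right ?_ (mul_nonneg (Real.log_natCast_nonneg p) (by positivity))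
    have hfin := Ideal.finite_setOfPred_absNorm_eq (S := 𝓞 K) p
    rw [idealsNormEqCard, Set.ncard_eq_toFinset_card _ hfin, Nat.cast_le]
    refine Finset.card_le_card fun P hP => ?_
    simpa using (Finset.mem_filter.mp hP).2
  calc ∑ I ∈ idealsNormLE K n, Real.log (Ideal.absNorm I)
      ≤ ∑ P ∈ T, ∑ k ∈ Finset.Icc 1 n,
        Real.log (Ideal.absNorm P) * (idealsNormLE K (n / Ideal.absNorm P ^ k)).card :=
        sum_log_absNorm_le n
    _ ≤ ∑ P ∈ T, (8 * C * n * ((Ideal.absNorm P).minFac : ℝ) ^ (-(3 / 2) : ℝ) +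
        if (Ideal.absNorm P).Prime then Real.log (Ideal.absNorm P) *
          ((idealsNormLE K (n / Ideal.absNorm P)).card : ℝ) else 0) :=
        Finset.sum_le_sum fun P hP =>
          sum_Icc_one_log_absNorm_mul_le (N := fun m => ((idealsNormLE K m).card : ℝ)) hC0 hC
            (hTmem P hP).1 (hTmem P hP).2 hn
    _ ≤ 8 * C * n * Z + ∑ p ∈ (Finset.Ioc 0 n).filter Nat.Prime, idealsNormEqCard K p *
        (Real.log p * (idealsNormLE K (n / p)).card) := by
        rw [Finset.sum_add_distrib, ← Finset.mul_sum]
        gcongr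
        exact hZ T hTmem
    _ ≤ 8 * C * n * Z + ∑ p ∈ (Finset.Ioc 0 n).filter Nat.Prime,
        (c * n * (idealsNormEqCard K p * (Real.log p / p)) + d * C' * Real.log p) := by
        gcongr with p hp
        have hpp := (Finset.mem_filter.mp hp).2
        have hlog := Real.log_natCast_nonneg p
        have hd : (idealsNormEqCard K p : ℝ) ≤ d := by
          exact_mod_cast idealsNormEqCard_le_finrank hpp
        calc (idealsNormEqCard K p : ℝ) * (Real.log p * (idealsNormLE K (n / p)).card)
            ≤ idealsNormEqCard K p * (Real.log p * (c * (n / p) + C')) := by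
              gcongr
              refine (hC' _).trans ?_
              gcongr
              exact Nat.cast_div_le
          _ = c * n * (idealsNormEqCard K p * (Real.log p / p)) +
              idealsNormEqCard K p * C' * Real.log p := by ring
          _ ≤ _ := by gcongr
    _ ≤ _ := by
        rw [Finset.sum_add_distrib, ← Finset.mul_sum, ← Finset.mul_sum]
        have := mul_le_mul_of_nonneg_left (sum_log_prime_le n)
          (show (0 : ℝ) ≤ d * C' by positivity)
        linarith

/-- Lower bound for the logarithmic sum over ideals. -/
lemma eventually_le_sum_log_absNorm {κ c : ℝ} (hcκ : c < κ)
    (hκ : Filter.Tendsto (fun n : ℕ => ((idealsNormLE K n).card : ℝ) / n)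
      Filter.atTop (nhds κ)) :
    ∃ A : ℝ, ∀ᶠ n : ℕ in Filter.atTop,
      c * n * Real.log n - A * n ≤ ∑ I ∈ idealsNormLE K n, Real.log (Ideal.absNorm I) := by
  obtain ⟨C, hC0, hC⟩ := exists_card_idealsNormLE_le_mul K
  obtain ⟨c', hcc', hc'κ⟩ := exists_between hcκ
  obtain ⟨M, hM⟩ := exists_nat_gt (C / (c' - c))
  have hpos : 0 < c' - c := by linarith
  have hM0 : (0 : ℝ) < M := lt_of_le_of_lt (by positivity) hM
  have hMN : 0 < M := by exact_mod_cast hM0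
  have hCM : C / M ≤ c' - c := by
    rw [div_lt_iff₀ hpos] at hM
    rw [div_le_iff₀ hM0]
    linarith
  refine ⟨C * Real.log M, ?_⟩
  filter_upwards [hκ.eventually_const_le hc'κ, Filter.eventually_ge_atTop M] with n hn hnM
  have hn0 : (0 : ℝ) < n := lt_of_lt_of_le hM0 (by exact_mod_cast hnM)
  rw [le_div_iff₀ hn0] at hn
  have hlogM : 0 ≤ Real.log M := Real.log_natCast_nonneg M
  have hlogn : Real.log M ≤ Real.log n := Real.log_le_log hM0 (by exact_mod_cast hnM)
  have hsub : idealsNormLE K (n / M) ⊆ idealsNormLE K n := fun I hI => by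
    rw [mem_idealsNormLE] at hI ⊢
    exact ⟨hI.1.trans (Nat.div_le_self _ _), hI.2⟩
  have hcard : ((idealsNormLE K n \ idealsNormLE K (n / M)).card : ℝ) =
      (idealsNormLE K n).card - (idealsNormLE K (n / M)).card := by
    rw [Finset.card_sdiff_of_subset hsub, Nat.cast_sub (Finset.card_le_card hsub)]
  have hlow : c * n ≤ ((idealsNormLE K n \ idealsNormLE K (n / M)).card : ℝ) := by
    have h1 : ((idealsNormLE K (n / M)).card : ℝ) ≤ (c' - c) * n :=
      calc ((idealsNormLE K (n / M)).card : ℝ) ≤ C * ((n / M : ℕ) : ℝ) := hC _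
        _ ≤ C * (n / M) := by
          gcongr
          exact Nat.cast_div_le
        _ = C / M * n := by ring
        _ ≤ _ := by gcongr
    rw [hcard]
    linarith
  have hupp : ((idealsNormLE K n \ idealsNormLE K (n / M)).card : ℝ) ≤ C * n := by
    refine le_trans ?_ (hC n)
    exact_mod_cast Finset.card_le_card Finset.sdiff_subset
  calc c * n * Real.log n - C * Real.log M * n
      ≤ (idealsNormLE K n \ idealsNormLE K (n / M)).card * (Real.log n - Real.log M) := by
        nlinarith [mul_le_mul_of_nonneg_right hlow (hlogM.trans hlogn),
          mul_le_mul_of_nonneg_right hupp hlogM]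
    _ = ∑ I ∈ idealsNormLE K n \ idealsNormLE K (n / M), Real.log (n / M) := by
        rw [Finset.sum_const, nsmul_eq_mul, Real.log_div hn0.ne' hM0.ne']
    _ ≤ ∑ I ∈ idealsNormLE K n \ idealsNormLE K (n / M), Real.log (Ideal.absNorm I) := by
        refine Finset.sum_le_sum fun I hI => Real.log_le_log (by positivity) ?_
        rw [Finset.mem_sdiff, mem_idealsNormLE, mem_idealsNormLE] at hI
        have h1 : n / M < Ideal.absNorm I := by
          by_contra h
          exact hI.2 ⟨not_lt.mp h, hI.1.2⟩
        rw [div_le_iff₀ hM0]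
        exact_mod_cast ((Nat.div_lt_iff_lt_mul hMN).mp h1).le
    _ ≤ _ := Finset.sum_le_sum_of_subset_of_nonneg Finset.sdiff_subset
        fun I _ _ => Real.log_natCast_nonneg _

variable (K) in
/-- Mertens-type lower bound for the primes of degree one of a number field. -/
theorem eventually_le_sum_idealsNormEqCard_mul_log_div {ε : ℝ} (hε : 0 < ε) :
    ∀ᶠ n : ℕ in Filter.atTop, (1 - ε) * Real.log n ≤
      ∑ p ∈ (Finset.Ioc 0 n).filter Nat.Prime, idealsNormEqCard K p * (Real.log p / p) := by
  obtain ⟨κ, hκ0, hκ⟩ := tendsto_card_idealsNormLE_div K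
  set δ := κ * ε / 4 with hδ
  have hδ0 : 0 < δ := by positivity
  obtain ⟨A, hA⟩ := exists_sum_log_absNorm_le (c := κ + δ) (by linarith) (by linarith) hκ
  obtain ⟨B, hB⟩ := eventually_le_sum_log_absNorm (c := κ - δ) (by linarith) hκ
  have hlog : Filter.Tendsto (fun n : ℕ => Real.log n) Filter.atTop Filter.atTop :=
    Real.tendsto_log_atTop.comp tendsto_natCast_atTop_atTop
  filter_upwards [hB, Filter.eventually_ge_atTop 1, hlog.eventually_ge_atTop ((A + B) / δ),
    hlog.eventually_ge_atTop 0] with n hn hn1 hlogn hlog0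
  have h1 := hA n hn1
  set S := ∑ p ∈ (Finset.Ioc 0 n).filter Nat.Prime, (idealsNormEqCard K p : ℝ) * (Real.log p / p)
  have hn0 : (0 : ℝ) < n := by exact_mod_cast hn1
  rw [div_le_iff₀ hδ0] at hlogn
  have h2 : (κ - δ) * Real.log n - B ≤ (κ + δ) * S + A := by
    have : n * ((κ - δ) * Real.log n - B) ≤ n * ((κ + δ) * S + A) := by linarith
    exact le_of_mul_le_mul_left this hn0
  have h3 : (κ - 2 * δ) * Real.log n ≤ (κ + δ) * S := by linarith
  have h4 : (κ + δ) * ((1 - ε) * Real.log n) ≤ (κ - 2 * δ) * Real.log n := by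
    have : (κ + δ) * (1 - ε) ≤ κ - 2 * δ := by
      have : κ * ε = 4 * δ := by rw [hδ]; ring
      nlinarith
    nlinarith
  exact le_of_mul_le_mul_left (h4.trans h3) (by linarith)

end NumberField

lemma card_roots_mul_div_le_card_filter_dvd (F : ℤ[X]) (p : ℕ) [Fact p.Prime] (n : ℕ) :
    (Finset.univ.filter fun z : ZMod p => aeval z F = 0).card * (n / p) ≤
      ((Finset.Ioc 0 n).filter fun k : ℕ => (p : ℤ) ∣ F.eval (k : ℤ)).card := by
  have hp := (Fact.out : p.Prime).pos
  rw [← Finset.card_range (n / p), ← Finset.card_product]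
  have hcast : ∀ z : ZMod p, ∀ j : ℕ, ((p * (j + 1) - (-z).val : ℕ) : ZMod p) = z := fun z j => by
    have h1 : (-z).val ≤ p * (j + 1) := (ZMod.val_lt (-z)).le.trans (by nlinarith)
    rw [Nat.cast_sub h1]
    simp
  refine Finset.card_le_card_of_injOn (fun x => p * (x.2 + 1) - (-x.1).val) ?_ ?_
  · rintro ⟨z, j⟩ hzj
    simp only [Finset.coe_product, Set.mem_prod, Finset.mem_coe, Finset.mem_filter,
      Finset.mem_univ, true_and, Finset.mem_range] at hzj
    have h1 := ZMod.val_lt (-z)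
    have h2 : p * (j + 1) ≤ n := by
      have := (Nat.le_div_iff_mul_le hp).mp (Nat.succ_le_of_lt hzj.2)
      rwa [mul_comm] at this
    have h3 : p ≤ p * (j + 1) := by nlinarith
    simp only [Finset.coe_filter, Set.mem_ofPred_eq, Finset.mem_Ioc]
    refine ⟨⟨by omega, by omega⟩, ?_⟩
    rw [← ZMod.intCast_zmod_eq_zero_iff_dvd]
    have h4 : ((F.eval ((p * (j + 1) - (-z).val : ℕ) : ℤ) : ℤ) : ZMod p) =
        aeval (((p * (j + 1) - (-z).val : ℕ) : ZMod p)) F := by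
      rw [aeval_def, algebraMap_int_eq]
      have := eval₂_at_apply (p := F) (Int.castRingHom (ZMod p))
        ((p * (j + 1) - (-z).val : ℕ) : ℤ)
      rw [eq_intCast, eq_intCast, Int.cast_natCast] at this
      exact this.symm
    rw [h4, hcast]
    exact hzj.1
  · rintro ⟨z, j⟩ - ⟨w, i⟩ - h
    simp only at h
    have hzw : z = w := by rw [← hcast z j, h, hcast]
    subst hzw
    have h1 := ZMod.val_lt (-z)
    have h2 : p ≤ p * (j + 1) := by nlinarith
    have h3 : p ≤ p * (i + 1) := by nlinarith
    have h4 : p * (j + 1) = p * (i + 1) := by omega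
    have := Nat.eq_of_mul_eq_mul_left hp h4
    simp_all

/-- The primes up to `n` account for at least `(1 - ε) n log n` in the product of the values of an
irreducible polynomial at `1, …, n`. -/
lemma eventually_le_sum_log_mul_card_filter_dvd {F : ℤ[X]}
    (hirr : Irreducible (F.map (Int.castRingHom ℚ))) {ε : ℝ} (hε : 0 < ε) :
    ∀ᶠ n : ℕ in Filter.atTop, (1 - ε) * (n * Real.log n) ≤
      ∑ p ∈ (Finset.Ioc 0 n).filter Nat.Prime, Real.log p *
        ((Finset.Ioc 0 n).filter fun k : ℕ => (p : ℤ) ∣ F.eval (k : ℤ)).card := by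
  have : Fact (Irreducible (F.map (Int.castRingHom ℚ))) := ⟨hirr⟩
  let K := AdjoinRoot (F.map (Int.castRingHom ℚ))
  have hfin : FiniteDimensional ℚ K := (AdjoinRoot.powerBasis hirr.ne_zero).finite
  have hK : NumberField K := { to_charZero := inferInstance, to_finiteDimensional := hfin }
  have hF : F ≠ 0 := by
    rintro rfl
    exact hirr.ne_zero (by simp)
  have hα : aeval (AdjoinRoot.root _ : K) F = 0 := by
    have h : aeval (AdjoinRoot.root _ : K) (F.map (algebraMap ℤ ℚ)) = 0 :=
      (AdjoinRoot.aeval_eq _).trans AdjoinRoot.mk_self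
    rwa [aeval_map_algebraMap] at h
  obtain ⟨p₀, hp₀⟩ := exists_forall_ncard_absNorm_eq_le_card_roots (K := K) hF hα
    AdjoinRoot.adjoinRoot_eq_top
  set d := Module.finrank ℤ (𝓞 K)
  set S₀ := ∑ p ∈ (Finset.Ioc 0 p₀).filter Nat.Prime,
    (idealsNormEqCard K p : ℝ) * (Real.log p / p) with hS₀
  have hlog : Filter.Tendsto (fun n : ℕ => Real.log n) Filter.atTop Filter.atTop :=
    Real.tendsto_log_atTop.comp tendsto_natCast_atTop_atTop
  filter_upwards [eventually_le_sum_idealsNormEqCard_mul_log_div K (half_pos hε),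
    Filter.eventually_ge_atTop p₀,
    hlog.eventually_ge_atTop ((S₀ + d * Real.log 4) / (ε / 2))] with n hn hnp hlogn
  rw [div_le_iff₀ (by positivity)] at hlogn
  have hterm : ∀ p ∈ (Finset.Ioc 0 n).filter Nat.Prime,
      n * (idealsNormEqCard K p * (Real.log p / p)) - d * Real.log p -
        (if p ≤ p₀ then n * (idealsNormEqCard K p * (Real.log p / p)) else 0) ≤
      Real.log p * ((Finset.Ioc 0 n).filter fun k : ℕ => (p : ℤ) ∣ F.eval (k : ℤ)).card := by
    intro p hp
    have hpp := (Finset.mem_filter.mp hp).2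
    have hlp := Real.log_natCast_nonneg p
    have hp0 : (0 : ℝ) < p := by exact_mod_cast hpp.pos
    split_ifs with h
    · have : 0 ≤ d * Real.log p := by positivity
      have h2 : 0 ≤ Real.log p *
        ((Finset.Ioc 0 n).filter fun k : ℕ => (p : ℤ) ∣ F.eval (k : ℤ)).card := by positivity
      linarith
    · have : Fact p.Prime := ⟨hpp⟩
      have h1 : idealsNormEqCard K p * (n / p) ≤
          ((Finset.Ioc 0 n).filter fun k : ℕ => (p : ℤ) ∣ F.eval (k : ℤ)).card :=
        (Nat.mul_le_mul_right _ (hp₀ p (not_le.mp h))).trans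
          (card_roots_mul_div_le_card_filter_dvd F p n)
      have h2 : ((n : ℝ) / p - 1) ≤ ((n / p : ℕ) : ℝ) := by
        have := Nat.lt_floor_add_one ((n : ℝ) / p)
        rw [Nat.floor_div_eq_div] at this
        linarith
      have hd : (idealsNormEqCard K p : ℝ) ≤ d := by
        exact_mod_cast idealsNormEqCard_le_finrank hpp
      calc n * (idealsNormEqCard K p * (Real.log p / p)) - d * Real.log p - 0
          ≤ n * (idealsNormEqCard K p * (Real.log p / p)) - idealsNormEqCard K p * Real.log p := by
            nlinarith [mul_le_mul_of_nonneg_right hd hlp]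
        _ = Real.log p * (idealsNormEqCard K p * ((n : ℝ) / p - 1)) := by ring
        _ ≤ Real.log p * (idealsNormEqCard K p * ((n / p : ℕ) : ℝ)) := by gcongr
        _ ≤ _ := by
            gcongr
            exact_mod_cast h1
  refine le_trans ?_ (Finset.sum_le_sum hterm)
  rw [Finset.sum_sub_distrib, Finset.sum_sub_distrib, ← Finset.mul_sum, ← Finset.mul_sum,
    ← Finset.sum_filter, Finset.filter_filter]
  have hfilter : (Finset.Ioc 0 n).filter (fun p => p.Prime ∧ p ≤ p₀) =
      (Finset.Ioc 0 p₀).filter Nat.Prime := by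
    ext p
    simp only [Finset.mem_filter, Finset.mem_Ioc]
    constructor
    · rintro ⟨⟨h1, h2⟩, h3, h4⟩
      exact ⟨⟨h1, h4⟩, h3⟩
    · rintro ⟨⟨h1, h2⟩, h3⟩
      exact ⟨⟨h1, h2.trans hnp⟩, h3, h2⟩
  rw [hfilter, ← Finset.mul_sum, ← hS₀]
  have h1 := mul_le_mul_of_nonneg_left (sum_log_prime_le n) (show (0 : ℝ) ≤ d by positivity)
  have h2 := mul_le_mul_of_nonneg_left hn (show (0 : ℝ) ≤ n by positivity)
  have h3 := mul_le_mul_of_nonneg_left hlogn (show (0 : ℝ) ≤ n by positivity)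
  linarith

lemma abs_eval_natCast_le (F : ℤ[X]) {k n : ℕ} (hk : 1 ≤ k) (hkn : k ≤ n) :
    |((F.eval (k : ℤ) : ℤ) : ℝ)| ≤
      (∑ i ∈ Finset.range (F.natDegree + 1), |(F.coeff i : ℝ)|) * (n : ℝ) ^ F.natDegree := by
  rw [eval_eq_sum_range, Finset.sum_mul]
  push_cast
  refine (Finset.abs_sum_le_sum_abs _ _).trans (Finset.sum_le_sum fun i hi => ?_)
  rw [abs_mul, abs_pow, Nat.abs_cast]
  have h1 : (1 : ℝ) ≤ n := by exact_mod_cast hk.trans hkn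
  gcongr
  calc (k : ℝ) ^ i ≤ (n : ℝ) ^ i := by gcongr
    _ ≤ _ := pow_le_pow_right₀ h1 (Nat.lt_succ_iff.mp (Finset.mem_range.mp hi))

lemma eval_ne_zero_of_irreducible {F : ℤ[X]} (hdeg : 2 ≤ F.natDegree)
    (hirr : Irreducible (F.map (Int.castRingHom ℚ))) (k : ℤ) : F.eval k ≠ 0 := by
  intro h
  have hroot : (F.map (Int.castRingHom ℚ)).IsRoot (k : ℚ) := by
    have := eval₂_at_apply (p := F) (Int.castRingHom ℚ) k
    rw [h, map_zero] at this
    rwa [IsRoot, eval_map]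
  have : (F.map (Int.castRingHom ℚ)).natDegree = 1 :=
    natDegree_eq_of_degree_eq_some (degree_eq_one_of_irreducible_of_root hirr hroot)
  rw [natDegree_map_eq_of_injective (Int.castRingHom ℚ).injective_int] at this
  omega

lemma sum_log_le_log_natAbs {m : ℤ} (hm : m ≠ 0) {s : Finset ℕ}
    (hs : ∀ p ∈ s, p.Prime ∧ (p : ℤ) ∣ m) : ∑ p ∈ s, Real.log p ≤ Real.log m.natAbs := by
  have hsub : s ⊆ m.natAbs.primeFactors := fun p hp => by
    rw [Nat.mem_primeFactors]
    exact ⟨(hs p hp).1, Int.natCast_dvd.mp (hs p hp).2, Int.natAbs_ne_zero.mpr hm⟩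
  rw [← Real.log_prod fun p hp => by exact_mod_cast (hs p hp).1.ne_zero, ← Nat.cast_prod]
  refine Real.log_le_log ?_ ?_
  · exact_mod_cast Finset.prod_pos fun p hp => (hs p hp).1.pos
  · exact_mod_cast Nat.le_of_dvd (Int.natAbs_pos.mpr hm)
      ((Finset.prod_dvd_prod_of_subset _ _ _ hsub).trans (Nat.prod_primeFactors_dvd _))

lemma exists_prime_of_lt_Pplus {m : ℕ} {y : ℝ} (hy : 1 ≤ y) (h : y < Pplus m) :
    ∃ p : ℕ, p.Prime ∧ p ∣ m ∧ y < p := by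
  by_contra! hcon
  refine absurd h (not_lt.mpr ?_)
  rw [Pplus]
  have : max 1 (m.primeFactors.sup id) ≤ ⌊y⌋₊ := by
    refine max_le (Nat.one_le_floor_iff y |>.mpr hy) (Finset.sup_le fun p hp => ?_)
    exact Nat.le_floor (hcon p (Nat.prime_of_mem_primeFactors hp) (Nat.dvd_of_mem_primeFactors hp))
  exact (Nat.cast_le.mpr this).trans (Nat.floor_le (by linarith))

/-- The values with a prime factor exceeding `y ≥ n` together with the prime factors up to `n`
contribute at most the full logarithmic sum. -/
lemma sum_log_mul_card_add_card_mul_log_le {F : ℤ[X]} (hF : ∀ k : ℤ, F.eval k ≠ 0) {n : ℕ} {y : ℝ}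
    (hn : (n : ℝ) ≤ y) (hy : 1 ≤ y) :
    ∑ p ∈ (Finset.Ioc 0 n).filter Nat.Prime, Real.log p *
        ((Finset.Ioc 0 n).filter fun k : ℕ => (p : ℤ) ∣ F.eval (k : ℤ)).card +
      ((Finset.Ioc 0 n).filter fun k : ℕ => y < Pplus (F.eval (k : ℤ)).natAbs).card * Real.log y ≤
    ∑ k ∈ Finset.Ioc 0 n, Real.log (F.eval (k : ℤ)).natAbs := by
  have h1 : ∑ p ∈ (Finset.Ioc 0 n).filter Nat.Prime, Real.log p *
        ((Finset.Ioc 0 n).filter fun k : ℕ => (p : ℤ) ∣ F.eval (k : ℤ)).card =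
      ∑ k ∈ Finset.Ioc 0 n, ∑ p ∈ ((Finset.Ioc 0 n).filter Nat.Prime).filter
        fun p : ℕ => (p : ℤ) ∣ F.eval (k : ℤ), Real.log p := by
    simp_rw [Finset.sum_filter (fun p : ℕ => (p : ℤ) ∣ F.eval _)]
    rw [Finset.sum_comm]
    refine Finset.sum_congr rfl fun p _ => ?_
    rw [← Finset.sum_filter, Finset.sum_const, nsmul_eq_mul, mul_comm]
  rw [h1, ← nsmul_eq_mul, ← Finset.sum_const, Finset.sum_filter, ← Finset.sum_add_distrib]
  refine Finset.sum_le_sum fun k _ => ?_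
  split_ifs with h
  · obtain ⟨q, hq, hqd, hyq⟩ := exists_prime_of_lt_Pplus hy h
    have hnot : q ∉ ((Finset.Ioc 0 n).filter Nat.Prime).filter
        fun p : ℕ => (p : ℤ) ∣ F.eval (k : ℤ) := by
      simp only [Finset.mem_filter, Finset.mem_Ioc]
      rintro ⟨⟨⟨-, hqn⟩, -⟩, -⟩
      have : (q : ℝ) ≤ n := by exact_mod_cast hqn
      linarith
    refine le_trans ?_ (sum_log_le_log_natAbs (hF k) (s := insert q (((Finset.Ioc 0 n).filter
      Nat.Prime).filter fun p : ℕ => (p : ℤ) ∣ F.eval (k : ℤ))) fun p hp => ?_)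
    · rw [Finset.sum_insert hnot, add_comm]
      gcongr
    · rcases Finset.mem_insert.mp hp with rfl | hp
      · exact ⟨hq, Int.natCast_dvd.mpr hqd⟩
      · simp only [Finset.mem_filter] at hp
        exact ⟨hp.1.2, hp.2⟩
  · rw [add_zero]
    refine sum_log_le_log_natAbs (hF k) fun p hp => ?_
    simp only [Finset.mem_filter] at hp
    exact ⟨hp.1.2, hp.2⟩

/-- Friable values of an irreducible polynomial (Théorème 1.5). -/
theorem friable_values_irreducible_polynomial
    (F : Polynomial ℤ) (g : ℕ) (hg : 2 ≤ g) (hdeg : F.natDegree = g)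
    (hirr : Irreducible (F.map (Int.castRingHom ℚ)))
    (ε : ℝ) (hε : 0 < ε) :
    ∃ x₀ : ℝ, ∀ x : ℝ, x₀ ≤ x → ∀ y : ℝ, x ^ (g - 1 : ℕ) < y → y ≤ x ^ (g : ℕ) →
      ∀ u : ℝ, u = Real.log x / Real.log y →
      (1 + u - g * u - ε) * x ≤
        (((Finset.Icc 1 ⌊x⌋₊).filter
            (fun n => F.eval (n : ℤ) ≠ 0 ∧ (Pplus (F.eval (n : ℤ)).natAbs : ℝ) ≤ y)).card : ℝ) := by
  have hF := eval_ne_zero_of_irreducible (hdeg ▸ hg) hirr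
  set B := ∑ i ∈ Finset.range (F.natDegree + 1), |(F.coeff i : ℝ)| with hB
  have hlarge := eventually_le_sum_log_mul_card_filter_dvd hirr (show 0 < ε / 3 by positivity)
  obtain ⟨x₀, hx₀⟩ := Filter.eventually_atTop.mp
    ((tendsto_nat_floor_atTop (α := ℝ)).eventually hlarge)
  obtain ⟨x₁, hx₁⟩ := Filter.eventually_atTop.mp
    (Real.tendsto_log_atTop.eventually_ge_atTop (|Real.log B| / (ε / 3)))
  refine ⟨max (max x₀ x₁) (max 2 (3 / ε)), fun x hx y hxy _ u hu => ?_⟩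
  have hxx₀ : x₀ ≤ x := (le_max_left _ _).trans ((le_max_left _ _).trans hx)
  have hxx₁ : x₁ ≤ x := (le_max_right _ _).trans ((le_max_left _ _).trans hx)
  have hx2 : 2 ≤ x := (le_max_left _ _).trans ((le_max_right _ _).trans hx)
  have hxε : 3 / ε ≤ x := (le_max_right _ _).trans ((le_max_right _ _).trans hx)
  rw [div_le_iff₀ hε] at hxε
  have hsmall := hx₀ x hxx₀
  have hlogB := hx₁ x hxx₁
  rw [div_le_iff₀ (by positivity)] at hlogB
  set n := ⌊x⌋₊ with hn
  have hnx : (n : ℝ) ≤ x := Nat.floor_le (by linarith)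
  have hxn : x < n + 1 := Nat.lt_floor_add_one x
  have hn1 : (1 : ℝ) ≤ n := by
    have : 1 ≤ n := Nat.one_le_floor_iff x |>.mpr (by linarith)
    exact_mod_cast this
  have hxy' : x < y := lt_of_le_of_lt (le_self_pow₀ (by linarith) (by omega)) hxy
  have hlogx : 0 < Real.log x := Real.log_pos (by linarith)
  have hlogxy : Real.log x ≤ Real.log y := Real.log_le_log (by linarith) hxy'.le
  have hlogy : 0 < Real.log y := by linarith
  have hlogn : Real.log n ≤ Real.log x := Real.log_le_log (by linarith) hnx
  have hlogn0 : 0 ≤ Real.log n := Real.log_natCast_nonneg n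
  have hmass := sum_log_mul_card_add_card_mul_log_le hF (n := n) (y := y) (by linarith)
    (by linarith)
  set bad := (Finset.Ioc 0 n).filter fun k : ℕ => y < Pplus (F.eval (k : ℤ)).natAbs with hbad
  have htotal : ∑ k ∈ Finset.Ioc 0 n, Real.log (F.eval (k : ℤ)).natAbs ≤
      n * (|Real.log B| + g * Real.log n) := by
    have hk : ∀ k ∈ Finset.Ioc 0 n, Real.log (F.eval (k : ℤ)).natAbs ≤
        |Real.log B| + g * Real.log n := fun k hk => by
      rw [Finset.mem_Ioc] at hk
      have h1 := abs_eval_natCast_le F hk.1 hk.2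
      rw [← hB, hdeg] at h1
      have h2 : (((F.eval (k : ℤ)).natAbs : ℕ) : ℝ) = |((F.eval (k : ℤ) : ℤ) : ℝ)| := by
        rw [Nat.cast_natAbs, Int.cast_abs]
      have h3 : 0 < |((F.eval (k : ℤ) : ℤ) : ℝ)| := abs_pos.mpr (by exact_mod_cast hF k)
      have hB0 : B ≠ 0 := by
        rintro h
        rw [h, zero_mul] at h1
        linarith
      rw [h2]
      calc _ ≤ Real.log (B * (n : ℝ) ^ g) := Real.log_le_log h3 h1
        _ = Real.log B + g * Real.log n := by
          rw [Real.log_mul hB0 (by positivity), Real.log_pow]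
        _ ≤ _ := by gcongr; exact le_abs_self _
    refine (Finset.sum_le_card_nsmul _ _ _ hk).trans_eq ?_
    rw [Nat.card_Ioc, Nat.sub_zero, nsmul_eq_mul]
  have hbadle : (bad.card : ℝ) * Real.log y ≤ x * ((g - 1 + 2 * (ε / 3)) * Real.log x) := by
    have hg1 : (2 : ℝ) ≤ g := by exact_mod_cast hg
    have h1 : (bad.card : ℝ) * Real.log y ≤
        n * (|Real.log B| + (g - 1 + ε / 3) * Real.log n) := by linarith
    refine h1.trans ?_
    have h2 : (g - 1 + ε / 3) * Real.log n ≤ (g - 1 + ε / 3) * Real.log x := by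
      gcongr
      linarith
    have h3 : |Real.log B| + (g - 1 + ε / 3) * Real.log n ≤
        (g - 1 + 2 * (ε / 3)) * Real.log x := by linarith
    refine mul_le_mul hnx h3 ?_ (by linarith)
    have : 0 ≤ (g - 1 + ε / 3) * Real.log n := mul_nonneg (by linarith) hlogn0
    positivity
  have hu1 : u ≤ 1 := by
    rw [hu, div_le_one hlogy]
    exact hlogxy
  have hbadu : (bad.card : ℝ) ≤ x * ((g - 1 + 2 * (ε / 3)) * u) := by
    rw [hu, ← mul_div_assoc, ← mul_div_assoc, le_div_iff₀ hlogy]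
    exact hbadle
  set good := (Finset.Icc 1 n).filter fun k : ℕ => F.eval (k : ℤ) ≠ 0 ∧
    (Pplus (F.eval (k : ℤ)).natAbs : ℝ) ≤ y with hgood
  have hsplit : (n : ℝ) ≤ good.card + bad.card := by
    have h1 : Finset.Icc 1 n ⊆ good ∪ bad := fun k hk => by
      rw [Finset.mem_union, hgood, Finset.mem_filter, hbad, Finset.mem_filter]
      rcases le_or_gt (Pplus (F.eval (k : ℤ)).natAbs : ℝ) y with h | h
      · exact Or.inl ⟨hk, hF k, h⟩
      · exact Or.inr ⟨hk, h⟩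
    have h2 := (Finset.card_le_card h1).trans (Finset.card_union_le _ _)
    rw [Nat.card_Icc, Nat.add_sub_cancel] at h2
    exact_mod_cast h2
  have hεu : x * (2 * (ε / 3) * u) ≤ x * (2 * (ε / 3)) :=
    mul_le_mul_of_nonneg_left (mul_le_of_le_one_right (by positivity) hu1) (by linarith)
  refine le_trans (b := (good.card : ℝ)) (by linarith) (Nat.cast_le.mpr
    (Finset.card_le_card_of_injOn (fun k : ℕ => (k : ℤ)) (fun k hk => ?_)
      Nat.cast_injective.injOn))
  rw [hgood, Finset.mem_coe, Finset.mem_filter] at hk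
  rw [Finset.mem_coe, Finset.mem_filter]
  refine ⟨?_, hk.2⟩
  simpa only [Finset.bind_def, Finset.pure_def, Finset.mem_sup, Finset.mem_singleton,
    Nat.cast_inj, exists_eq_right'] using hk.1
end
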